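/- arXiv:2505.07221 — 2 statements merged into one kernel-verified Lean document; each statement's English description precedes it below -/
import Mathlib

section
/- For every index k and every positive integer N, F_N(k;t) = G_N(k^∨;t) as elements of the rational function field ℚ(t). -/
open scoped Classical

/-- The Kawashima-like function `F_N(k;t) ∈ ℚ(t)` attached to an index `k`
(given as a list):
`F_N(k;t) = ∑_{A⊂[r]} (-1)^{#A} ∑_{(n₁,…,n_r) ∈ S̄_{r,N}(A)}
  (∏_{i∈A} 1/(N-nᵢ+t)^{kᵢ}) (∏_{i∉A} 1/nᵢ^{kᵢ})`,
where in `S̄_{r,N}(A)` the comparison between consecutive entries is strict exactly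
when the later position lies in `A`. -/
noncomputable def FNL (N : ℕ) (k : List ℕ) : RatFunc ℚ :=
  ∑ A : Finset (Fin k.length),
    (-1 : RatFunc ℚ) ^ A.card *
    ∑ n ∈ Finset.univ.filter (fun n : Fin k.length → Fin N =>
      (∀ i, 0 < (n i : ℕ)) ∧
      ∀ (i : Fin k.length) (h : (i : ℕ) + 1 < k.length),
        if (⟨(i : ℕ) + 1, h⟩ : Fin k.length) ∈ A then n i < n ⟨(i : ℕ) + 1, h⟩
        else n i ≤ n ⟨(i : ℕ) + 1, h⟩),
      ∏ i : Fin k.length,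
        if i ∈ A then
          1 / ((N : RatFunc ℚ) - ((n i : ℕ) : RatFunc ℚ) + RatFunc.X) ^ k.get i
        else 1 / (((n i : ℕ) : RatFunc ℚ)) ^ k.get i

/-- The factor `(-1)^{n_r-1} · binom(t, n_r) · (1-N)_{n_r} / (1-N-t)_{n_r}` appearing
in `G_N`, where `(a)_m` is the rising factorial and `t = RatFunc.X`. -/
noncomputable def lastFactor (N nr : ℕ) : RatFunc ℚ :=
  (-1 : RatFunc ℚ) ^ (nr - 1) *
    ((∏ j ∈ Finset.range nr, (RatFunc.X - ((j : ℕ) : RatFunc ℚ))) /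
      ((Nat.factorial nr : ℕ) : RatFunc ℚ)) *
    (∏ j ∈ Finset.range nr, ((1 : RatFunc ℚ) - (N : RatFunc ℚ) + ((j : ℕ) : RatFunc ℚ))) /
    (∏ j ∈ Finset.range nr,
      ((1 : RatFunc ℚ) - (N : RatFunc ℚ) - RatFunc.X + ((j : ℕ) : RatFunc ℚ)))

/-- The function `G_N(k;t) ∈ ℚ(t)`: the sum over `A ⊂ [r]¹_k ∖ {r}` and tuples
`(n₁,…,n_r) ∈ S⋆_{r,N}(A)` (with `nᵢ ≤ nᵢ₊₁` when `i ∈ A` or `i+1 ∉ A`, and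
`nᵢ < nᵢ₊₁` when `i ∉ A` and `i+1 ∈ A`) of
`(∏_{i∈A} 1/(N-nᵢ+t))·(∏_{i∉A} 1/nᵢ^{kᵢ})·(-1)^{n_r-1}·binom(t,n_r)·(1-N)_{n_r}/(1-N-t)_{n_r}`. -/
noncomputable def GNL (N : ℕ) (k : List ℕ) : RatFunc ℚ :=
  ∑ A : Finset (Fin k.length),
    if ∀ i ∈ A, k.get i = 1 ∧ (i : ℕ) + 1 ≠ k.length then
      ∑ n ∈ Finset.univ.filter (fun n : Fin k.length → Fin N =>
        (∀ i, 0 < (n i : ℕ)) ∧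
        ∀ (i : Fin k.length) (h : (i : ℕ) + 1 < k.length),
          if i ∉ A ∧ (⟨(i : ℕ) + 1, h⟩ : Fin k.length) ∈ A then
            n i < n ⟨(i : ℕ) + 1, h⟩
          else n i ≤ n ⟨(i : ℕ) + 1, h⟩),
        (∏ i : Fin k.length,
          if i ∈ A then 1 / ((N : RatFunc ℚ) - ((n i : ℕ) : RatFunc ℚ) + RatFunc.X)
          else 1 / (((n i : ℕ) : RatFunc ℚ)) ^ k.get i) *
        (∏ i : Fin k.length,
          if (i : ℕ) + 1 = k.length then lastFactor N (n i : ℕ) else 1)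
    else 0

/-- The set of proper partial sums `{k₁, k₁+k₂, …, k₁+⋯+k_{r-1}}` of an index. -/
def psums (k : List ℕ) : Finset ℕ :=
  (Finset.Ico 1 k.length).image (fun i => (k.take i).sum)

/-- `HoffmanDual k l` says that `l = k^∨` is the Hoffman dual of `k`:  both are
indices (tuples of positive integers) of the same weight `w`, and their sets of
proper partial sums are complementary subsets of `{1,…,w-1}`. -/
def HoffmanDual (k l : List ℕ) : Prop :=
  (∀ x ∈ k, 0 < x) ∧ (∀ x ∈ l, 0 < x) ∧ k.sum = l.sum ∧
    Disjoint (psums k) (psums l) ∧ psums k ∪ psums l = Finset.Ico 1 k.sum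


namespace HD

section transfer
variable {K σ : Type} [Field K]

/-- summand of the transfer-matrix sum -/
noncomputable def Zs (W : ℕ → σ → K) (τ : σ → σ → K) (E : σ → K) (k : List ℕ)
    (s : Fin k.length → σ) : K :=
  (∏ i, W (k.get i) (s i)) *
    ∏ i : Fin k.length, if h : (i : ℕ) + 1 < k.length then τ (s i) (s ⟨(i : ℕ) + 1, h⟩) else E (s i)

noncomputable def R [Fintype σ] (W : ℕ → σ → K) (τ : σ → σ → K) (E : σ → K) : List ℕ → σ → K
  | [], s => E s
  | a :: ks, s => ∑ s', τ s s' * (W a s' * R W τ E ks s')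

lemma Zs_cons_cons (W : ℕ → σ → K) (τ : σ → σ → K) (E : σ → K) (a b : ℕ) (ks : List ℕ)
    (x : σ) (s : Fin (b :: ks).length → σ) :
    Zs W τ E (a :: b :: ks) (Fin.cons x s : Fin ((b :: ks).length + 1) → σ)
      = W a x * (τ x (s ⟨0, by simp⟩) * Zs W τ E (b :: ks) s) := by
  have h1 : (∏ i : Fin (a :: b :: ks).length, W ((a :: b :: ks).get i)
      ((Fin.cons x s : Fin ((b :: ks).length + 1) → σ) i)) =
      W a x * ∏ i : Fin (b :: ks).length, W ((b :: ks).get i) (s i) := by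
    exact Fin.prod_univ_succ (n := (b :: ks).length) _
  have h2 : (∏ i : Fin (a :: b :: ks).length, if h : (i : ℕ) + 1 < (a :: b :: ks).length then
        τ ((Fin.cons x s : Fin ((b :: ks).length + 1) → σ) i)
          ((Fin.cons x s : Fin ((b :: ks).length + 1) → σ) ⟨(i : ℕ) + 1, h⟩)
        else E ((Fin.cons x s : Fin ((b :: ks).length + 1) → σ) i)) =
      τ x (s ⟨0, by simp⟩) * ∏ i : Fin (b :: ks).length,
        if h : (i : ℕ) + 1 < (b :: ks).length then τ (s i) (s ⟨(i : ℕ) + 1, h⟩) else E (s i) := by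
    refine (Fin.prod_univ_succ (n := (b :: ks).length) _).trans ?_
    congr 1
    refine Finset.prod_congr rfl fun i _ => ?_
    by_cases h : (i : ℕ) + 1 < (b :: ks).length
    · have h' : ((i.succ : Fin _) : ℕ) + 1 < (a :: b :: ks).length := by
        simp at h ⊢; omega
      rw [dif_pos h, dif_pos h']
      rfl
    · have h' : ¬ ((i.succ : Fin _) : ℕ) + 1 < (a :: b :: ks).length := by
        simp at h ⊢; omega
      rw [dif_neg h, dif_neg h']
      rfl
  unfold Zs
  rw [h1, h2]
  ring

lemma sum_Zs [Fintype σ] (W : ℕ → σ → K) (τ : σ → σ → K) (E : σ → K) (ks : List ℕ) :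
    ∀ (a : ℕ) (φ : σ → K), ∑ s : Fin (a :: ks).length → σ, φ (s ⟨0, by simp⟩) * Zs W τ E (a :: ks) s
      = ∑ x, φ x * (W a x * R W τ E ks x) := by
  induction ks with
  | nil =>
    intro a φ
    refine Fintype.sum_equiv (Equiv.funUnique (Fin 1) σ) _ _ fun s => ?_
    simp [Zs, R]
  | cons b ks ih =>
    intro a φ
    refine ((Fin.consEquiv (fun _ : Fin ((b :: ks).length + 1) => σ)).sum_comp
      (fun s => φ (s ⟨0, by simp⟩) * Zs W τ E (a :: b :: ks) s)).symm.trans ?_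
    rw [Fintype.sum_prod_type]
    refine Finset.sum_congr rfl fun x _ => ?_
    have : ∀ s : Fin (b :: ks).length → σ,
      φ (((Fin.consEquiv (fun _ : Fin ((b :: ks).length + 1) => σ)) (x, s)) ⟨0, by simp⟩) *
        Zs W τ E (a :: b :: ks) ((Fin.consEquiv (fun _ : Fin ((b :: ks).length + 1) => σ)) (x, s)) =
        φ x * W a x * (τ x (s ⟨0, by simp⟩) * Zs W τ E (b :: ks) s) := by
      intro s
      have := Zs_cons_cons W τ E a b ks x s
      change φ x * Zs W τ E (a :: b :: ks) (Fin.cons x s : Fin ((b :: ks).length + 1) → σ) = _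
      rw [this]; ring
    refine (Finset.sum_congr rfl fun s _ => this s).trans ?_
    rw [← Finset.mul_sum, ih b (τ x), R]
    ring

end transfer

lemma mem_psums_cons (a : ℕ) (ks : List ℕ) (x : ℕ) :
    x ∈ psums (a :: ks) ↔ ∃ i < ks.length, x = a + (ks.take i).sum := by
  unfold psums
  simp only [Finset.mem_image, Finset.mem_Ico, List.length_cons]
  constructor
  · rintro ⟨i, ⟨h1, h2⟩, rfl⟩
    obtain ⟨j, rfl⟩ : ∃ j, i = j + 1 := ⟨i - 1, by omega⟩
    exact ⟨j, by omega, by simp⟩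
  · rintro ⟨i, h, rfl⟩
    exact ⟨i + 1, ⟨by omega, by omega⟩, by simp⟩

lemma HD_iff (k l : List ℕ) : HoffmanDual k l ↔
    (∀ x ∈ k, 0 < x) ∧ (∀ x ∈ l, 0 < x) ∧ k.sum = l.sum ∧
    (∀ x, x ∈ psums k → x ∉ psums l) ∧ ∀ x, (x ∈ psums k ∨ x ∈ psums l) ↔ (1 ≤ x ∧ x < k.sum) := by
  unfold HoffmanDual
  rw [Finset.disjoint_left, Finset.ext_iff]
  simp only [Finset.mem_union, Finset.mem_Ico]

lemma HD_symm {k l : List ℕ} (h : HoffmanDual k l) : HoffmanDual l k := by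
  rw [HD_iff] at *
  obtain ⟨h1, h2, h3, h4, h5⟩ := h
  exact ⟨h2, h1, h3.symm, fun x hx hx' => h4 x hx' hx, fun x => by rw [or_comm, h5, h3]⟩

lemma psums_pos {k : List ℕ} (hk : ∀ x ∈ k, 0 < x) {x : ℕ} (hx : x ∈ psums k) : 0 < x := by
  cases k with
  | nil => simp [psums] at hx
  | cons a ks =>
    obtain ⟨i, -, rfl⟩ := (mem_psums_cons _ _ _).1 hx
    have := hk a (by simp)
    omega

lemma psums_one_cons (c : ℕ) (cs : List ℕ) (x : ℕ) (hx : 0 < x) :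
    x ∈ psums (c :: cs) ↔ x + 1 ∈ psums (1 :: c :: cs) := by
  rw [mem_psums_cons, mem_psums_cons]
  constructor
  · rintro ⟨i, h, rfl⟩
    exact ⟨i + 1, by simpa using h, by simp; omega⟩
  · rintro ⟨i, h, h'⟩
    cases i with
    | zero => simp at h'; omega
    | succ j => exact ⟨j, by simpa using h, by simp at h'; omega⟩

lemma psums_succ_cons (b : ℕ) (cs : List ℕ) (x : ℕ) :
    x ∈ psums (b :: cs) ↔ x + 1 ∈ psums ((b + 1) :: cs) := by
  rw [mem_psums_cons, mem_psums_cons]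
  constructor
  · rintro ⟨i, h, rfl⟩
    exact ⟨i, h, by omega⟩
  · rintro ⟨i, h, h'⟩
    exact ⟨i, h, by omega⟩

lemma one_mem_psums (a : ℕ) (ks : List ℕ) (hk : ∀ x ∈ a :: ks, 0 < x) :
    1 ∈ psums (a :: ks) ↔ a = 1 ∧ ks ≠ [] := by
  have ha := hk a (by simp)
  rw [mem_psums_cons]
  constructor
  · rintro ⟨i, h, h'⟩
    refine ⟨by omega, ?_⟩
    rintro rfl
    simp at h
  · rintro ⟨rfl, h⟩
    exact ⟨0, List.length_pos_iff.2 h, by simp⟩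

lemma HD_reduce (c : ℕ) (cs : List ℕ) (b : ℕ) (ls : List ℕ) (hb : 0 < b)
    (h : HoffmanDual (1 :: c :: cs) ((b + 1) :: ls)) : HoffmanDual (c :: cs) (b :: ls) := by
  rw [HD_iff] at *
  obtain ⟨h1, h2, h3, h4, h5⟩ := h
  have g1 : ∀ x ∈ c :: cs, 0 < x := fun x hx => h1 x (by simp at hx ⊢; tauto)
  have g2 : ∀ x ∈ b :: ls, 0 < x := by
    intro x hx
    rcases List.mem_cons.1 hx with rfl | hx
    · exact hb
    · exact h2 x (by simp [hx])
  refine ⟨g1, g2, by simp at h3 ⊢; omega, ?_, ?_⟩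
  · intro x hx hx'
    have := psums_pos g1 hx
    exact h4 (x + 1) ((psums_one_cons _ _ _ this).1 hx) ((psums_succ_cons _ _ _).1 hx')
  · intro x
    rcases Nat.eq_zero_or_pos x with rfl | hx
    · constructor
      · rintro (h | h)
        · exact absurd (psums_pos g1 h) (by simp)
        · exact absurd (psums_pos g2 h) (by simp)
      · rintro ⟨h, -⟩
        omega
    · rw [psums_one_cons _ _ _ hx, psums_succ_cons b ls, h5]
      simp only [List.sum_cons]
      omega

lemma dual_one {a : ℕ} {ks l : List ℕ} (h : HoffmanDual (a :: ks) l) (hm : 1 ∈ psums (a :: ks)) :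
    ∃ c cs b ls, 0 < b ∧ a = 1 ∧ ks = c :: cs ∧ l = (b + 1) :: ls ∧ HoffmanDual (c :: cs) (b :: ls) := by
  have hh := h
  rw [HD_iff] at hh
  obtain ⟨h1, h2, h3, h4, h5⟩ := hh
  obtain ⟨rfl, hne⟩ := (one_mem_psums _ _ h1).1 hm
  cases ks with
  | nil => exact absurd rfl hne
  | cons c cs =>
    have hc := h1 c (by simp)
    cases l with
    | nil => simp at h3
    | cons d ls =>
      have hd := h2 d (by simp)
      have hd1 : d ≠ 1 := by
        rintro rfl
        cases ls with
        | nil => simp at h3; omega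
        | cons e es => exact h4 1 hm ((one_mem_psums _ _ h2).2 ⟨rfl, by simp⟩)
      obtain ⟨b, rfl⟩ : ∃ b, d = b + 1 := ⟨d - 1, by omega⟩
      exact ⟨c, cs, b, ls, by omega, rfl, rfl, rfl, HD_reduce _ _ _ _ (by omega) h⟩

lemma dual_cases {k l : List ℕ} (h : HoffmanDual k l) (hk : k ≠ []) :
    (k = [1] ∧ l = [1]) ∨
    (∃ c cs b ls, 0 < b ∧ k = 1 :: c :: cs ∧ l = (b + 1) :: ls ∧ HoffmanDual (c :: cs) (b :: ls)) ∨
    (∃ c cs b ls, 0 < b ∧ l = 1 :: c :: cs ∧ k = (b + 1) :: ls ∧ HoffmanDual (b :: ls) (c :: cs)) := by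
  have hh := h
  rw [HD_iff] at hh
  obtain ⟨h1, h2, h3, h4, h5⟩ := hh
  have key : ∀ d : List ℕ, (∀ x ∈ d, 0 < x) → d.sum = 1 → d = [1] := by
    intro d hd hs
    match d with
    | [] => simp at hs
    | [a] => simp at hs; simp [hs]
    | a :: b :: e =>
      have := hd a (by simp)
      have := hd b (by simp)
      simp at hs; omega
  by_cases hs : k.sum = 1
  · exact Or.inl ⟨key k h1 hs, key l h2 (h3 ▸ hs)⟩
  · have hk1 : 1 < k.sum := by
      cases k with
      | nil => exact absurd rfl hk
      | cons a ks =>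
        have := h1 a (by simp)
        simp at hs ⊢; omega
    rcases (h5 1).2 ⟨le_rfl, hk1⟩ with hm | hm
    · cases k with
      | nil => exact absurd rfl hk
      | cons a ks =>
        obtain ⟨c, cs, b, ls, hb, rfl, rfl, rfl, h'⟩ := dual_one h hm
        exact Or.inr (Or.inl ⟨c, cs, b, ls, hb, rfl, rfl, h'⟩)
    · cases l with
      | nil => simp [psums] at hm
      | cons a ks =>
        obtain ⟨c, cs, b, ls, hb, rfl, rfl, rfl, h'⟩ := dual_one (HD_symm h) hm
        exact Or.inr (Or.inr ⟨c, cs, b, ls, hb, rfl, rfl, HD_symm h'⟩)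


section kernel
variable {K : Type} [Field K]

/-- the connecting kernel -/
noncomputable def c (D : K) (n m : ℕ) : K :=
  (∏ j ∈ Finset.range (n - 1), (((j : K) + 1) - m) / ((j : K) + 1)) *
    ∏ j ∈ Finset.range n, (D - ((j : K) + 1)) / (D - ((j : K) + 1) - m)

lemma c_one (D : K) (m : ℕ) : c D 1 m = (D - 1) / (D - 1 - m) := by
  simp [c]

variable [CharZero K]

lemma c_succ (D : K) (hD : ∀ z : ℕ, D - z ≠ 0) (n m : ℕ) (hn : 0 < n) :
    c D (n + 1) m * (n * (D - (n + 1) - m)) = c D n m * ((n - m) * (D - (n + 1))) := by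
  obtain ⟨n, rfl⟩ : ∃ j, n = j + 1 := ⟨n - 1, by omega⟩
  unfold c
  rw [Finset.prod_range_succ _ (n + 1)]
  simp only [Nat.add_sub_cancel]
  rw [Finset.prod_range_succ _ n]
  have h1 : (n : K) + 1 ≠ 0 := by exact_mod_cast Nat.succ_ne_zero n
  have h2 : D - ((n : K) + 1 + 1) - m ≠ 0 := by
    have := hD (n + 1 + 1 + m)
    push_cast at this
    convert this using 1; ring
  push_cast
  field_simp

lemma c_succ' (D : K) (hD : ∀ z : ℕ, D - z ≠ 0) (n m : ℕ) (hn : 0 < n) :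
    c D (n + 1) m = c D n m * ((n - m) * (D - (n + 1))) / (n * (D - (n + 1) - m)) := by
  rw [← c_succ D hD n m hn, mul_div_assoc, div_self, mul_one]
  have h1 : (n : K) ≠ 0 := by exact_mod_cast hn.ne'
  have h2 : D - ((n : K) + 1) - m ≠ 0 := by
    have := hD (n + 1 + m)
    push_cast at this
    convert this using 1; ring
  exact mul_ne_zero h1 h2

lemma c_zero (D : K) (hD : ∀ z : ℕ, D - z ≠ 0) (n m : ℕ) (hm : 0 < m) (h : m < n) :
    c D n m = 0 := by
  induction n with
  | zero => omega
  | succ n ih =>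
    rw [c_succ' D hD n m (by omega)]
    rcases Nat.lt_or_ge m n with h' | h'
    · rw [ih h']; simp
    · obtain rfl : m = n := by omega
      simp

lemma c_m (D : K) (hD : ∀ z : ℕ, D - z ≠ 0) (n m : ℕ) (hn : 0 < n) :
    c D n (m + 1) * ((m + 1 - n) * (D - n - 1 - m)) = c D n m * (m * (D - 1 - m)) := by
  induction n with
  | zero => omega
  | succ n ih =>
    rcases Nat.eq_zero_or_pos n with rfl | hn'
    · simp only [Nat.zero_add, c_one]
      have h1 := hD (1 + m)
      have h2 := hD (1 + (m + 1))
      push_cast at *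
      have h1' : D - 1 - m ≠ 0 := by convert h1 using 1; ring
      have h2' : D - 1 - (m + 1) ≠ 0 := by convert h2 using 1; ring
      field_simp
      ring
    · have ih := ih hn'
      rw [c_succ' D hD n m hn', c_succ' D hD n (m + 1) hn']
      have h1 := hD (n + 1 + m)
      have h2 := hD (n + 1 + (m + 1))
      push_cast at *
      have h0 : (n : K) ≠ 0 := by exact_mod_cast hn'.ne'
      have h1' : D - (n + 1) - m ≠ 0 := by convert h1 using 1; ring
      have h2' : D - (n + 1) - (m + 1) ≠ 0 := by convert h2 using 1; ring
      rw [div_mul_eq_mul_div, div_mul_eq_mul_div, div_eq_div_iff (by positivity) (by positivity)]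
      linear_combination ((n - m) * (D - (n + 1)) * n * (D - (n+1) - (m+1))) * ih

/-- telescoping in `m` -/
lemma c_sum (D : K) (hD : ∀ z : ℕ, D - z ≠ 0) (n m : ℕ) (hn : 0 < n) :
    ∑ j ∈ Finset.Ico 1 (m + 1), c D n j / (D - j) = c D n m * m / (n * (D - n)) := by
  have h0 : (n : K) ≠ 0 := by exact_mod_cast hn.ne'
  have h1 := hD n
  induction m with
  | zero => simp
  | succ m ih =>
    rw [Finset.sum_Ico_succ_top (by omega), ih]
    have h2 := hD (m + 1)
    have h3 := c_m D hD n m hn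
    push_cast at *
    field_simp
    linear_combination -h3

end kernel

section relations
variable {K : Type} [Field K] [CharZero K]

lemma colA (D : K) (hD : ∀ z : ℕ, D - z ≠ 0) (n m M : ℕ) (hn : 0 < n) (hm : 0 < m) (h : n ≤ M) :
    ∑ j ∈ Finset.Ico n M, c D j m / j - ∑ j ∈ Finset.Ico (n + 1) (M + 1), c D j m / (D - j)
      = (c D n m - c D M m) / m := by
  induction M, h using Nat.le_induction with
  | base => simp
  | succ M h ih =>
    rw [Finset.sum_Ico_succ_top h, Finset.sum_Ico_succ_top (by omega), add_sub_add_comm, ih]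
    have h1 := hD (M + 1)
    have h2 : (M : K) ≠ 0 := by exact_mod_cast (by omega : M ≠ 0)
    have h3 : (m : K) ≠ 0 := by exact_mod_cast hm.ne'
    have h4 := c_succ D hD M m (by omega)
    push_cast at *
    field_simp
    linear_combination h4

lemma colB (D : K) (hD : ∀ z : ℕ, D - z ≠ 0) (n m M : ℕ) (hn : 0 < n) (h : n ≤ M) :
    ∑ j ∈ Finset.Ico n M, c D j m * (m - j) / j
      + ∑ j ∈ Finset.Ico (n + 1) (M + 1), c D j m * (D - j - m) / (D - j) = 0 := by
  induction M, h using Nat.le_induction with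
  | base => simp
  | succ M h ih =>
    rw [Finset.sum_Ico_succ_top h, Finset.sum_Ico_succ_top (by omega), add_add_add_comm, ih]
    have h1 := hD (M + 1)
    have h2 : (M : K) ≠ 0 := by exact_mod_cast (by omega : M ≠ 0)
    have h4 := c_succ D hD M m (by omega)
    push_cast at *
    field_simp
    linear_combination h4

/-- The relation between the two kinds of suffix sums. -/
def Rel (N : ℕ) (D : K) (p q a b : ℕ → K) : Prop :=
  ∀ n, 0 < n → n < N →
    p n = ∑ m ∈ Finset.Ico 1 N, c D n m * (a m + (m - n) * (b m / (D - m))) ∧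
    q n = ∑ m ∈ Finset.Ico 1 N, c D n m * (a m - (D - n - m) * (b m / (D - m)))

lemma sumY (N : ℕ) (D : K) (hD : ∀ z : ℕ, D - z ≠ 0) (p q a b : ℕ → K) (h : Rel N D p q a b)
    (n : ℕ) (hn : 0 < n) (hnN : n ≤ N) :
    ∑ j ∈ Finset.Ico n N, p j / j - ∑ j ∈ Finset.Ico (n + 1) N, q j / (D - j)
      = ∑ m ∈ Finset.Ico 1 N, c D n m * (a m / m) := by
  have e1 : ∑ j ∈ Finset.Ico n N, p j / j = ∑ m ∈ Finset.Ico 1 N, ∑ j ∈ Finset.Ico n N,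
      c D j m * (a m + (m - j) * (b m / (D - m))) / j := by
    rw [Finset.sum_comm]
    refine Finset.sum_congr rfl fun j hj => ?_
    rw [Finset.mem_Ico] at hj
    rw [(h j (by omega) hj.2).1, Finset.sum_div]
  have e2 : ∑ j ∈ Finset.Ico (n + 1) N, q j / (D - j) =
      ∑ m ∈ Finset.Ico 1 N, ∑ j ∈ Finset.Ico (n + 1) N,
      c D j m * (a m - (D - j - m) * (b m / (D - m))) / (D - j) := by
    rw [Finset.sum_comm]
    refine Finset.sum_congr rfl fun j hj => ?_
    rw [Finset.mem_Ico] at hj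
    rw [(h j (by omega) hj.2).2, Finset.sum_div]
  rw [e1, e2, ← Finset.sum_sub_distrib]
  refine Finset.sum_congr rfl fun m hm => ?_
  rw [Finset.mem_Ico] at hm
  have hc : c D N m = 0 := c_zero D hD N m (by omega) hm.2
  have e3 : ∑ j ∈ Finset.Ico (n + 1) N, c D j m * (a m - (D - j - m) * (b m / (D - m))) / (D - j)
      = ∑ j ∈ Finset.Ico (n + 1) (N + 1),
        c D j m * (a m - (D - j - m) * (b m / (D - m))) / (D - j) := by
    rcases hnN.lt_or_eq with h' | rfl
    · rw [Finset.sum_Ico_succ_top (by omega), hc]; simp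
    · simp
  have hA := colA D hD n m N hn (by omega) hnN
  have hB := colB D hD n m N hn hnN
  rw [hc, sub_zero] at hA
  rw [e3]
  have e4 : ∑ j ∈ Finset.Ico n N, c D j m * (a m + (m - j) * (b m / (D - m))) / j =
      a m * ∑ j ∈ Finset.Ico n N, c D j m / j +
      (b m / (D - m)) * ∑ j ∈ Finset.Ico n N, c D j m * (m - j) / j := by
    rw [Finset.mul_sum, Finset.mul_sum, ← Finset.sum_add_distrib]
    refine Finset.sum_congr rfl fun j _ => ?_
    ring
  have e5 : ∑ j ∈ Finset.Ico (n + 1) (N + 1),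
        c D j m * (a m - (D - j - m) * (b m / (D - m))) / (D - j) =
      a m * ∑ j ∈ Finset.Ico (n + 1) (N + 1), c D j m / (D - j) -
      (b m / (D - m)) * ∑ j ∈ Finset.Ico (n + 1) (N + 1), c D j m * (D - j - m) / (D - j) := by
    rw [Finset.mul_sum, Finset.mul_sum, ← Finset.sum_sub_distrib]
    refine Finset.sum_congr rfl fun j _ => ?_
    ring
  rw [e4, e5]
  linear_combination a m * hA + (b m / (D - m)) * hB

lemma relY (N : ℕ) (D : K) (hD : ∀ z : ℕ, D - z ≠ 0) (p q a b : ℕ → K) (h : Rel N D p q a b)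
    (p' a' b' : ℕ → K)
    (hp : ∀ n, 0 < n → n < N → p' n = ∑ j ∈ Finset.Ico n N, p j / j -
      ∑ j ∈ Finset.Ico (n + 1) N, q j / (D - j))
    (ha : ∀ m, 0 < m → m < N → a' m = a m / m) (hb : ∀ m, 0 < m → m < N → b' m = 0) :
    Rel N D p' p' a' b' := by
  intro n hn hnN
  rw [hp n hn hnN, sumY N D hD p q a b h n hn hnN.le]
  constructor
  all_goals
    refine Finset.sum_congr rfl fun m hm => ?_
    rw [Finset.mem_Ico] at hm
    rw [ha m (by omega) hm.2, hb m (by omega) hm.2]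
    simp

lemma relTotal (N : ℕ) (D : K) (hD : ∀ z : ℕ, D - z ≠ 0) (p q a b : ℕ → K) (h : Rel N D p q a b) :
    ∑ j ∈ Finset.Ico 1 N, p j / j - ∑ j ∈ Finset.Ico 1 N, q j / (D - j)
      = ∑ m ∈ Finset.Ico 1 N, a m / m + ∑ m ∈ Finset.Ico 1 N, b m / (D - m) := by
  rcases Nat.lt_or_ge 1 N with hN | hN
  · rw [Finset.sum_eq_sum_Ico_succ_bot hN (fun j => q j / (D - j)), ← sub_sub, sub_right_comm,
      sumY N D hD p q a b h 1 one_pos hN.le, (h 1 one_pos hN).2, Finset.sum_div,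
      ← Finset.sum_sub_distrib, ← Finset.sum_add_distrib]
    refine Finset.sum_congr rfl fun m hm => ?_
    rw [Finset.mem_Ico] at hm
    have h3 : (m : K) ≠ 0 := by exact_mod_cast (by omega : m ≠ 0)
    have h1 := hD 1
    have h2 := hD (1 + m)
    have h4 := hD m
    push_cast at *
    have h2' : D - 1 - m ≠ 0 := by convert h2 using 1; ring
    rw [c_one]
    field_simp
    ring
  · simp [Finset.Ico_eq_empty_of_le hN]

lemma abel (N : ℕ) (D : K) (hD : ∀ z : ℕ, D - z ≠ 0) (g : ℕ → K) (n : ℕ) (hn : 0 < n) :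
    ∑ m ∈ Finset.Ico 1 N, c D n m / (D - m) * ∑ j ∈ Finset.Ico m N, g j =
      ∑ m ∈ Finset.Ico 1 N, c D n m * m / (n * (D - n)) * g m := by
  simp only [Finset.mul_sum]
  rw [Finset.sum_Ico_Ico_comm]
  refine Finset.sum_congr rfl fun m _ => ?_
  rw [← Finset.sum_mul, c_sum D hD n m hn]

lemma relX (N : ℕ) (D : K) (hD : ∀ z : ℕ, D - z ≠ 0) (p q a b : ℕ → K) (h : Rel N D p q a b)
    (p' q' a' b' : ℕ → K)
    (hp : ∀ n, 0 < n → n < N → p' n = p n / n)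
    (hq : ∀ n, 0 < n → n < N → q' n = q n / (D - n))
    (ha : ∀ m, 0 < m → m < N → a' m = ∑ j ∈ Finset.Ico m N, a j / j +
      ∑ j ∈ Finset.Ico (m + 1) N, b j / (D - j))
    (hb : ∀ m, 0 < m → m < N → b' m = ∑ j ∈ Finset.Ico m N, a j / j +
      ∑ j ∈ Finset.Ico m N, b j / (D - j)) :
    Rel N D p' q' a' b' := by
  intro n hn hnN
  have hb' : ∀ m, 0 < m → m < N → b' m = ∑ j ∈ Finset.Ico m N, (a j / j + b j / (D - j)) := by
    intro m h1 h2
    rw [hb m h1 h2, Finset.sum_add_distrib]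
  have ha' : ∀ m, 0 < m → m < N → a' m = b' m - b m / (D - m) := by
    intro m h1 h2
    rw [ha m h1 h2, hb m h1 h2, Finset.sum_eq_sum_Ico_succ_bot h2 (fun j => b j / (D - j))]
    ring
  have hab := abel N D hD (fun j => a j / j + b j / (D - j)) n hn
  have h0 : (n : K) ≠ 0 := by exact_mod_cast hn.ne'
  have h1 := hD n
  rw [hp n hn hnN, hq n hn hnN, (h n hn hnN).1, (h n hn hnN).2]
  constructor
  · have e1 : ∑ m ∈ Finset.Ico 1 N, c D n m * (a' m + (m - n) * (b' m / (D - m))) =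
        (D - n) * ∑ m ∈ Finset.Ico 1 N, c D n m / (D - m) *
          (∑ j ∈ Finset.Ico m N, (a j / j + b j / (D - j))) -
        ∑ m ∈ Finset.Ico 1 N, c D n m * (b m / (D - m)) := by
      rw [Finset.mul_sum, ← Finset.sum_sub_distrib]
      refine Finset.sum_congr rfl fun m hm => ?_
      rw [Finset.mem_Ico] at hm
      rw [ha' m (by omega) hm.2, ← hb' m (by omega) hm.2]
      have h2 := hD m
      field_simp
      ring
    rw [e1, hab, Finset.mul_sum, ← Finset.sum_sub_distrib, Finset.sum_div]
    refine Finset.sum_congr rfl fun m hm => ?_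
    rw [Finset.mem_Ico] at hm
    have h2 := hD m
    have h3 : (m : K) ≠ 0 := by exact_mod_cast (by omega : m ≠ 0)
    field_simp
    ring
  · have e1 : ∑ m ∈ Finset.Ico 1 N, c D n m * (a' m - (D - n - m) * (b' m / (D - m))) =
        n * ∑ m ∈ Finset.Ico 1 N, c D n m / (D - m) *
          (∑ j ∈ Finset.Ico m N, (a j / j + b j / (D - j))) -
        ∑ m ∈ Finset.Ico 1 N, c D n m * (b m / (D - m)) := by
      rw [Finset.mul_sum, ← Finset.sum_sub_distrib]
      refine Finset.sum_congr rfl fun m hm => ?_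
      rw [Finset.mem_Ico] at hm
      rw [ha' m (by omega) hm.2, ← hb' m (by omega) hm.2]
      have h2 := hD m
      field_simp
      ring
    rw [e1, hab, Finset.mul_sum, ← Finset.sum_sub_distrib, Finset.sum_div]
    refine Finset.sum_congr rfl fun m hm => ?_
    rw [Finset.mem_Ico] at hm
    have h2 := hD m
    have h3 : (m : K) ≠ 0 := by exact_mod_cast (by omega : m ≠ 0)
    field_simp
    ring

/-- Normalization: `∑ c(n,m) L(m)` is independent of `n`. -/
lemma norm_step (N : ℕ) (t D : K) (hDt : D = N + t) (hD : ∀ z : ℕ, D - z ≠ 0)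
    (L : ℕ → K)
    (hL : ∀ m, 0 < m → L (m + 1) * ((m + 1) * (D - 1 - m)) = - L m * ((t - m) * (N - 1 - m)))
    (ht : ∀ z : ℕ, t - z ≠ 0)
    (n : ℕ) (hn : 0 < n) (hnN : n + 1 < N) :
    ∑ m ∈ Finset.Ico 1 N, c D n m * L m = ∑ m ∈ Finset.Ico 1 N, c D (n + 1) m * L m := by
  have h0 : (n : K) ≠ 0 := by exact_mod_cast hn.ne'
  have hN : (N : K) - 1 - n ≠ 0 := by
    have : ((N - 1 - n : ℕ) : K) ≠ 0 := by exact_mod_cast (by omega : N - 1 - n ≠ 0)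
    rwa [Nat.cast_sub (by omega), Nat.cast_sub (by omega), Nat.cast_one] at this
  set U : ℕ → K := fun m => c D n m * L m * m * (m - n) with hU
  have key : ∀ m, 0 < m → (N - 1 - n) * (t - n) * (c D n m * L m - c D (n + 1) m * L m) * n =
      - (D - 2 * n - 1) * (U (m + 1) - U m) := by
    intro m hm
    have h1 := hD (n + 1 + m)
    have h2 := hD (1 + m)
    push_cast at h1 h2
    have h1' : D - (n + 1) - m ≠ 0 := by convert h1 using 1; ring
    have h2' : D - 1 - m ≠ 0 := by convert h2 using 1; ring
    have hm1 : (m : K) + 1 ≠ 0 := by exact_mod_cast Nat.succ_ne_zero m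
    have e1 := c_m D hD n m hn
    have e2 := hL m hm
    have e3 : (U (m + 1)) * (D - n - 1 - m) = - c D n m * L m * m * ((t - m) * (N - 1 - m)) := by
      simp only [hU]
      apply mul_right_cancel₀ h2'
      push_cast
      linear_combination (L (m+1) * (m+1) * (D - 1 - m)) * e1 + c D n m * m * (D - 1 - m) * e2
    have e4 := c_succ D hD n m hn
    have h1'' : D - n - 1 - m ≠ 0 := by convert h1 using 1; ring
    apply mul_right_cancel₀ h1''
    have e5 : U m = c D n m * L m * m * (m - n) := rfl
    rw [sub_mul, mul_sub] 
    subst hDt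
    linear_combination (-(N - 1 - n) * (t - n) * L m) * e4 + ((N : K) + t - 2 * n - 1) * e3 -
      ((N : K) + t - 2 * n - 1) * ((N : K) + t - n - 1 - m) * e5
  have tel : ∑ m ∈ Finset.Ico 1 N, (U (m + 1) - U m) = U N - U 1 :=
    Finset.sum_Ico_sub U (by omega)
  have hU1 : U 1 = 0 := by
    simp only [hU]
    rcases Nat.lt_or_ge 1 n with h | h
    · rw [c_zero D hD n 1 one_pos h]; simp
    · obtain rfl : n = 1 := by omega
      simp
  have hUN : U N = 0 := by
    obtain ⟨M, rfl⟩ : ∃ M, N = M + 1 := ⟨N - 1, by omega⟩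
    have e2 := hL M (by omega)
    have h2 := hD (1 + M)
    push_cast at h2 e2
    have h2' : D - 1 - M ≠ 0 := by convert h2 using 1; ring
    have hm1 : (M : K) + 1 ≠ 0 := by exact_mod_cast Nat.succ_ne_zero M
    have : L (M + 1) = 0 := by
      have : L (M + 1) * ((M + 1) * (D - 1 - M)) = 0 := by rw [e2]; ring
      exact (mul_eq_zero.1 this).resolve_right (mul_ne_zero hm1 h2')
    simp [hU, this]
  have hs : (N - 1 - n) * (t - n) * (∑ m ∈ Finset.Ico 1 N, (c D n m * L m - c D (n + 1) m * L m)) * n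
      = 0 := by
    rw [Finset.mul_sum, Finset.sum_mul, Finset.sum_congr rfl fun m hm =>
      key m (by rw [Finset.mem_Ico] at hm; omega), ← Finset.mul_sum, tel, hU1, hUN]
    simp
  rw [Finset.sum_sub_distrib] at hs
  have := (mul_eq_zero.1 hs).resolve_right h0
  exact sub_eq_zero.1 ((mul_eq_zero.1 this).resolve_left (mul_ne_zero hN (ht n)))

lemma norm_all (N : ℕ) (t D : K) (hDt : D = N + t) (hD : ∀ z : ℕ, D - z ≠ 0)
    (L : ℕ → K)
    (hL : ∀ m, 0 < m → L (m + 1) * ((m + 1) * (D - 1 - m)) = - L m * ((t - m) * (N - 1 - m)))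
    (ht : ∀ z : ℕ, t - z ≠ 0) (h1 : c D (N - 1) (N - 1) * L (N - 1) = 1)
    (d : ℕ) : ∀ n : ℕ, 0 < n → n + 1 + d = N →
    ∑ m ∈ Finset.Ico 1 N, c D n m * L m = 1 := by
  induction d with
  | zero =>
    intro n hn hnN
    obtain rfl : N = n + 1 := by omega
    rw [Finset.sum_Ico_succ_top (by omega), Finset.sum_eq_zero, zero_add]
    · exact h1
    · intro m hm
      rw [Finset.mem_Ico] at hm
      rw [c_zero D hD n m (by omega) hm.2, zero_mul]
  | succ d ih =>
    intro n hn hnN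
    rw [norm_step N t D hDt hD L hL ht n hn (by omega)]
    exact ih (n + 1) (by omega) (by omega)

lemma relBase (N : ℕ) (t D : K) (hDt : D = N + t) (hD : ∀ z : ℕ, D - z ≠ 0)
    (L : ℕ → K)
    (hL : ∀ m, 0 < m → L (m + 1) * ((m + 1) * (D - 1 - m)) = - L m * ((t - m) * (N - 1 - m)))
    (ht : ∀ z : ℕ, t - z ≠ 0) (h1 : 1 < N → c D (N - 1) (N - 1) * L (N - 1) = 1) :
    Rel N D (fun _ => 1) (fun _ => 1) L (fun _ => 0) := by
  intro n hn hnN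
  have := norm_all N t D hDt hD L hL ht (h1 (by omega)) (N - 1 - n) n hn (by omega)
  simp [this]

end relations

section suffix
variable {K : Type} [Field K]

noncomputable def RF (N : ℕ) (D : K) : List ℕ → Bool → ℕ → K
  | [], _, _ => 1
  | a :: ks, _, n => ∑ j ∈ Finset.Ico n N, 1 / (j : K) ^ a * RF N D ks false j -
      ∑ j ∈ Finset.Ico (n + 1) N, 1 / (D - j) ^ a * RF N D ks true j

noncomputable def RG (N : ℕ) (D : K) (L : ℕ → K) : List ℕ → Bool → ℕ → K
  | [], false, m => L m
  | [], true, _ => 0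
  | a :: ks, false, m => ∑ j ∈ Finset.Ico m N, 1 / (j : K) ^ a * RG N D L ks false j +
      ∑ j ∈ Finset.Ico (m + 1) N, (if a = 1 then 1 / (D - j) * RG N D L ks true j else 0)
  | a :: ks, true, m => ∑ j ∈ Finset.Ico m N, 1 / (j : K) ^ a * RG N D L ks false j +
      ∑ j ∈ Finset.Ico m N, (if a = 1 then 1 / (D - j) * RG N D L ks true j else 0)

noncomputable def WF (N : ℕ) (D : K) (a : ℕ) (s : Bool × Fin N) : K :=
  if 0 < (s.2 : ℕ) then (if s.1 then -(1 / (D - (s.2 : ℕ)) ^ a) else 1 / ((s.2 : ℕ) : K) ^ a) else 0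

noncomputable def tF (K : Type) [Field K] (N : ℕ) (s s' : Bool × Fin N) : K :=
  if (if s'.1 = true then s.2 < s'.2 else s.2 ≤ s'.2) then 1 else 0

noncomputable def WG (N : ℕ) (D : K) (a : ℕ) (s : Bool × Fin N) : K :=
  if 0 < (s.2 : ℕ) then (if s.1 then (if a = 1 then 1 / (D - (s.2 : ℕ)) else 0)
    else 1 / ((s.2 : ℕ) : K) ^ a) else 0

noncomputable def tG (K : Type) [Field K] (N : ℕ) (s s' : Bool × Fin N) : K :=
  if (if s.1 = false ∧ s'.1 = true then s.2 < s'.2 else s.2 ≤ s'.2) then 1 else 0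

noncomputable def EG (N : ℕ) (L : ℕ → K) (s : Bool × Fin N) : K :=
  if s.1 then 0 else L (s.2 : ℕ)

lemma sum_state (N : ℕ) (g : Bool × Fin N → K) (f : Bool → ℕ → K)
    (h : ∀ s, g s = f s.1 (s.2 : ℕ)) :
    ∑ s : Bool × Fin N, g s =
      ∑ j ∈ Finset.range N, f true j + ∑ j ∈ Finset.range N, f false j := by
  rw [Finset.sum_congr rfl fun s _ => h s, Fintype.sum_prod_type, Fintype.sum_bool, Fin.sum_univ_eq_sum_range (fun j => f true j),
    Fin.sum_univ_eq_sum_range (fun j => f false j)]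

lemma sum_range_ite (N n : ℕ) (f g : ℕ → K) (h : ∀ j, j < N → f j = if n ≤ j then g j else 0) :
    ∑ j ∈ Finset.range N, f j = ∑ j ∈ Finset.Ico n N, g j := by
  rw [Finset.sum_congr rfl fun j hj => h j (Finset.mem_range.1 hj), ← Finset.sum_filter]
  congr 1
  ext j
  simp only [Finset.mem_filter, Finset.mem_range, Finset.mem_Ico]
  tauto

lemma R_eq_RF (N : ℕ) (D : K) (ks : List ℕ) : ∀ (e : Bool) (n : Fin N), 0 < (n : ℕ) →
    R (WF N D) (tF K N) (fun _ => 1) ks (e, n) = RF N D ks e n := by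
  induction ks with
  | nil => intro e n hn; simp [R, RF]
  | cons a ks ih =>
    intro e n hn
    rw [R, RF]
    have : ∀ s' : Bool × Fin N, tF K N (e, n) s' * (WF N D a s' * R (WF N D) (tF K N) (fun _ => 1) ks s')
        = (fun (e' : Bool) (j : ℕ) => (if (if e' = true then (n : ℕ) < j else (n : ℕ) ≤ j) then
          (if e' then -(1 / (D - j) ^ a) else 1 / (j : K) ^ a) * RF N D ks e' j else 0)) s'.1 (s'.2 : ℕ) := by
      rintro ⟨e', j⟩
      by_cases hj : 0 < (j : ℕ)
      · rw [ih e' j hj]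
        cases e' <;> simp [tF, WF, hj]
        split_ifs <;> simp
      · have h1 : ¬ n ≤ j := by rw [Fin.le_def]; omega
        have h2 : ¬ n < j := by rw [Fin.lt_def]; omega
        cases e' <;> simp [tF, h1, h2]
    rw [sum_state N _ (fun (e' : Bool) (j : ℕ) => (if (if e' = true then (n : ℕ) < j else (n : ℕ) ≤ j) then (if e' then -(1 / (D - j) ^ a) else 1 / (j : K) ^ a) * RF N D ks e' j else 0)) this, sub_eq_add_neg, add_comm,
      ← Finset.sum_neg_distrib]
    congr 1
    · exact sum_range_ite N n _ _ fun j _ => by simp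
    · exact sum_range_ite N (n + 1) _ _ fun j _ => by simp

lemma R_eq_RG (N : ℕ) (D : K) (L : ℕ → K) (ks : List ℕ) : ∀ (e : Bool) (n : Fin N), 0 < (n : ℕ) →
    R (WG N D) (tG K N) (EG N L) ks (e, n) = RG N D L ks e n := by
  induction ks with
  | nil => intro e n hn; cases e <;> simp [R, RG, EG]
  | cons a ks ih =>
    intro e n hn
    rw [R]
    have : ∀ s' : Bool × Fin N, tG K N (e, n) s' * (WG N D a s' * R (WG N D) (tG K N) (EG N L) ks s')
        = (fun (e' : Bool) (j : ℕ) =>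
          (if (if e = false ∧ e' = true then (n : ℕ) < j else (n : ℕ) ≤ j) then
          (if e' then (if a = 1 then 1 / (D - j) else 0) else 1 / (j : K) ^ a)
            * RG N D L ks e' j else 0)) s'.1 (s'.2 : ℕ) := by
      rintro ⟨e', j⟩
      by_cases hj : 0 < (j : ℕ)
      · rw [ih e' j hj]
        cases e <;> cases e' <;> simp [tG, WG, hj] <;> split_ifs <;> rfl
      · have h1 : ¬ n ≤ j := by rw [Fin.le_def]; omega
        have h2 : ¬ n < j := by rw [Fin.lt_def]; omega
        cases e <;> cases e' <;> simp [tG, h1, h2]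
    rw [sum_state N _ (fun (e' : Bool) (j : ℕ) => (if (if e = false ∧ e' = true then (n : ℕ) < j else (n : ℕ) ≤ j) then (if e' then (if a = 1 then 1 / (D - j) else 0) else 1 / (j : K) ^ a) * RG N D L ks e' j else 0)) this, add_comm]
    cases e
    · rw [RG]
      congr 1
      · exact sum_range_ite N n _ _ fun j _ => by simp
      · exact sum_range_ite N (n + 1) _ _ fun j _ => by simp [Nat.succ_le_iff]
    · rw [RG]
      congr 1
      · exact sum_range_ite N n _ _ fun j _ => by simp
      · exact sum_range_ite N n _ _ fun j _ => by simp

lemma sum_finset_states (r N : ℕ) (f : (Fin r → Bool) → (Fin r → Fin N) → K) :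
    ∑ A : Finset (Fin r), ∑ n : Fin r → Fin N, f (fun i => decide (i ∈ A)) n =
      ∑ s : Fin r → Bool × Fin N, f (fun i => (s i).1) (fun i => (s i).2) := by
  rw [← (Equiv.arrowProdEquivProdArrow (Fin r) (fun _ => Bool) (fun _ => Fin N)).symm.sum_comp,
    Fintype.sum_prod_type]
  refine Fintype.sum_bijective (fun (A : Finset (Fin r)) (i : Fin r) => decide (i ∈ A)) ?_ _ _ ?_
  · constructor
    · intro A B h
      ext i
      have := congrFun h i
      simpa using this
    · intro g
      exact ⟨Finset.univ.filter (fun i => g i = true), by ext i; simp⟩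
  · intro A
    rfl

lemma sumF_total (N : ℕ) (D : K) (a : ℕ) (ks : List ℕ) :
    ∑ s, Zs (WF N D) (tF K N) (fun _ => 1) (a :: ks) s =
    ∑ j ∈ Finset.Ico 1 N, 1 / (j : K) ^ a * RF N D ks false j -
      ∑ j ∈ Finset.Ico 1 N, 1 / (D - j) ^ a * RF N D ks true j := by
  have := sum_Zs (WF N D) (tF K N) (fun _ => 1) ks a (fun _ => 1)
  simp only [one_mul] at this
  rw [this]
  have : ∀ s' : Bool × Fin N, (WF N D a s' * R (WF N D) (tF K N) (fun _ => 1) ks s')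
        = (fun (e' : Bool) (j : ℕ) => (if 0 < j then
          (if e' then -(1 / (D - j) ^ a) else 1 / (j : K) ^ a) * RF N D ks e' j else 0)) s'.1 (s'.2 : ℕ) := by
    rintro ⟨e', j⟩
    by_cases hj : 0 < (j : ℕ)
    · rw [R_eq_RF N D ks e' j hj]
      cases e' <;> simp [WF, hj]
    · cases e' <;> simp [WF, hj]
  rw [sum_state N _ (fun (e' : Bool) (j : ℕ) => (if 0 < j then (if e' then -(1 / (D - j) ^ a) else 1 / (j : K) ^ a) * RF N D ks e' j else 0)) this, sub_eq_add_neg, add_comm,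
      ← Finset.sum_neg_distrib]
  congr 1
  · exact sum_range_ite N 1 _ _ fun j _ => by simp [Nat.succ_le_iff]
  · exact sum_range_ite N 1 _ _ fun j _ => by simp [Nat.succ_le_iff]

lemma sumG_total (N : ℕ) (D : K) (L : ℕ → K) (a : ℕ) (ks : List ℕ) :
    ∑ s, Zs (WG N D) (tG K N) (EG N L) (a :: ks) s =
    ∑ j ∈ Finset.Ico 1 N, 1 / (j : K) ^ a * RG N D L ks false j +
      ∑ j ∈ Finset.Ico 1 N, (if a = 1 then 1 / (D - j) * RG N D L ks true j else 0) := by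
  have := sum_Zs (WG N D) (tG K N) (EG N L) ks a (fun _ => 1)
  simp only [one_mul] at this
  rw [this]
  have : ∀ s' : Bool × Fin N, (WG N D a s' * R (WG N D) (tG K N) (EG N L) ks s')
        = (fun (e' : Bool) (j : ℕ) => (if 0 < j then
          (if e' then (if a = 1 then 1 / (D - j) else 0) else 1 / (j : K) ^ a)
            * RG N D L ks e' j else 0)) s'.1 (s'.2 : ℕ) := by
    rintro ⟨e', j⟩
    by_cases hj : 0 < (j : ℕ)
    · rw [R_eq_RG N D L ks e' j hj]
      cases e' <;> simp [WG, hj]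
    · cases e' <;> simp [WG, hj]
  rw [sum_state N _ (fun (e' : Bool) (j : ℕ) => (if 0 < j then (if e' then (if a = 1 then 1 / (D - j) else 0) else 1 / (j : K) ^ a) * RG N D L ks e' j else 0)) this, add_comm]
  congr 1
  · exact sum_range_ite N 1 _ _ fun j _ => by simp [Nat.succ_le_iff]
  · exact sum_range_ite N 1 _ _ fun j _ => by simp [Nat.succ_le_iff]

/-- suffix sums with one unit of the first entry removed -/
noncomputable def PF (N : ℕ) (D : K) : List ℕ → Bool → ℕ → K
  | [], _, _ => 0
  | a :: ks, false, n => 1 / (n : K) ^ (a - 1) * RF N D ks false n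
  | a :: ks, true, n => 1 / (D - n) ^ (a - 1) * RF N D ks true n

noncomputable def QG (N : ℕ) (D : K) (L : ℕ → K) : List ℕ → Bool → ℕ → K
  | [], _, _ => 0
  | a :: ks, false, n => 1 / (n : K) ^ (a - 1) * RG N D L ks false n
  | a :: ks, true, n => if a = 1 then RG N D L ks true n else 0

lemma pow_split (x y : K) (a : ℕ) (ha : 0 < a) : 1 / x ^ a * y = 1 / x ^ (a - 1) * y / x := by
  obtain ⟨b, rfl⟩ : ∃ b, a = b + 1 := ⟨a - 1, by omega⟩
  rw [Nat.add_sub_cancel, pow_succ, one_div, one_div, mul_inv]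
  rw [div_eq_mul_inv]; ring

lemma main_rel [CharZero K] (N : ℕ) (D : K) (hD : ∀ z : ℕ, D - z ≠ 0) (L : ℕ → K)
    (hbase : Rel N D (fun _ => 1) (fun _ => 1) L (fun _ => 0)) (w : ℕ) :
    ∀ k l : List ℕ, k.sum = w → k ≠ [] → HoffmanDual k l →
      Rel N D (PF N D k false) (PF N D k true) (QG N D L l false) (QG N D L l true) := by
  induction w using Nat.strong_induction_on with
  | _ w ih =>
    intro k l hw hk h
    rcases dual_cases h hk with ⟨rfl, rfl⟩ | ⟨c, cs, b, ls, hb, rfl, rfl, h'⟩ |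
      ⟨c, cs, b, ls, hb, rfl, rfl, h'⟩
    · intro n hn hnN
      have := hbase n hn hnN
      simpa [PF, QG, RF, RG] using this
    · have hc : 0 < c := h'.1 c (by simp)
      have IH := ih (c :: cs).sum (by rw [← hw]; simp) (c :: cs) (b :: ls) rfl (by simp) h'
      have hpq : PF N D (1 :: c :: cs) true = PF N D (1 :: c :: cs) false := by
        funext n
        simp [PF, RF]
      rw [hpq]
      refine relY N D hD _ _ _ _ IH _ _ _ ?_ ?_ ?_
      · intro n hn hnN
        simp only [PF, Nat.sub_self, pow_zero, div_one, one_mul, RF]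
        congr 1
        · exact Finset.sum_congr rfl fun j _ => pow_split _ _ _ hc
        · exact Finset.sum_congr rfl fun j _ => pow_split _ _ _ hc
      · intro m hm hmN
        simp only [QG, Nat.add_sub_cancel]
        exact pow_split _ _ _ hb
      · intro m hm hmN
        simp [QG, hb.ne']
    · have hc : 0 < c := h'.2.1 c (by simp)
      have IH := ih (b :: ls).sum (by rw [← hw]; simp) (b :: ls) (c :: cs) rfl (by simp) h'
      refine relX N D hD _ _ _ _ IH _ _ _ _ ?_ ?_ ?_ ?_
      · intro n hn hnN
        simp only [PF, Nat.add_sub_cancel]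
        exact pow_split _ _ _ hb
      · intro n hn hnN
        simp only [PF, Nat.add_sub_cancel]
        exact pow_split _ _ _ hb
      · intro m hm hmN
        simp only [QG, Nat.sub_self, pow_zero, div_one, one_mul, RG]
        congr 1
        · exact Finset.sum_congr rfl fun j _ => pow_split _ _ _ hc
        · refine Finset.sum_congr rfl fun j _ => ?_
          split_ifs
          · ring
          · simp
      · intro m hm hmN
        simp only [QG, RG, if_true]
        congr 1
        · exact Finset.sum_congr rfl fun j _ => pow_split _ _ _ hc
        · refine Finset.sum_congr rfl fun j _ => ?_
          split_ifs
          · ring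
          · simp

lemma total_eq [CharZero K] (N : ℕ) (D : K) (hD : ∀ z : ℕ, D - z ≠ 0) (L : ℕ → K)
    (hbase : Rel N D (fun _ => 1) (fun _ => 1) L (fun _ => 0)) (a b : ℕ) (ks ls : List ℕ)
    (h : HoffmanDual (a :: ks) (b :: ls)) :
    ∑ s, Zs (WF N D) (tF K N) (fun _ => 1) (a :: ks) s =
      ∑ s, Zs (WG N D) (tG K N) (EG N L) (b :: ls) s := by
  have ha : 0 < a := h.1 a (by simp)
  have hb : 0 < b := h.2.1 b (by simp)
  have := relTotal N D hD _ _ _ _ (main_rel N D hD L hbase _ _ _ rfl (by simp) h)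
  rw [sumF_total, sumG_total]
  simp only [PF, QG] at this
  simp only [pow_split _ _ a ha, pow_split _ _ b hb]
  rw [this]
  congr 1
  refine Finset.sum_congr rfl fun j _ => ?_
  split_ifs
  · ring
  · simp

end suffix

lemma X_add_int_ne (z : ℤ) : (RatFunc.X : RatFunc ℚ) + (z : RatFunc ℚ) ≠ 0 := by
  have h : (Polynomial.X + Polynomial.C (z : ℚ)) ≠ 0 := Polynomial.X_add_C_ne_zero _
  have h2 := (map_ne_zero_iff (algebraMap (Polynomial ℚ) (RatFunc ℚ))
    (RatFunc.algebraMap_injective ℚ)).2 h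
  simpa using h2

lemma prod_sub_self (K : Type) [Field K] (j : ℕ) :
    ∏ i ∈ Finset.range j, ((i : K) - j) = (-1) ^ j * (Nat.factorial j : K) := by
  induction j with
  | zero => simp
  | succ j ih =>
    rw [Finset.prod_range_succ', Finset.prod_congr rfl fun i _ =>
      (by push_cast; ring : (((i + 1 : ℕ) : K) - ((j + 1 : ℕ) : K)) = (i : K) - j), ih,
      Nat.factorial_succ]
    push_cast
    ring

lemma lastFactor_step (N : ℕ) (m : ℕ) (hm : 0 < m) :
    lastFactor N (m + 1) * (((m : RatFunc ℚ) + 1) * (((N : RatFunc ℚ) + RatFunc.X) - 1 - (m : RatFunc ℚ))) =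
      - lastFactor N m * ((RatFunc.X - (m : RatFunc ℚ)) * ((N : RatFunc ℚ) - 1 - (m : RatFunc ℚ))) := by
  obtain ⟨j, rfl⟩ : ∃ j, m = j + 1 := ⟨m - 1, by omega⟩
  unfold lastFactor
  rw [Finset.prod_range_succ _ (j + 1), Finset.prod_range_succ _ (j + 1),
    Finset.prod_range_succ _ (j + 1), Nat.factorial_succ (j + 1)]
  have hP : ∏ j ∈ Finset.range (j + 1),
      ((1 : RatFunc ℚ) - (N : RatFunc ℚ) - RatFunc.X + ((j : ℕ) : RatFunc ℚ)) ≠ 0 := by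
    refine Finset.prod_ne_zero_iff.2 fun i _ => ?_
    have := X_add_int_ne (N - 1 - i)
    push_cast at this
    intro h
    apply this
    linear_combination -h
  have hx : (1 : RatFunc ℚ) - (N : RatFunc ℚ) - RatFunc.X + ((j + 1 : ℕ) : RatFunc ℚ) ≠ 0 := by
    have := X_add_int_ne (N - 1 - (j + 1))
    push_cast at this ⊢
    intro h
    apply this
    linear_combination -h
  have hf : ((Nat.factorial (j + 1) : ℕ) : RatFunc ℚ) ≠ 0 := by
    exact_mod_cast Nat.factorial_ne_zero _
  have hj : ((j : RatFunc ℚ) + 1 + 1) ≠ 0 := by exact_mod_cast Nat.succ_ne_zero (j + 1)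
  generalize (∏ j ∈ Finset.range (j + 1),
      ((1 : RatFunc ℚ) - (N : RatFunc ℚ) - RatFunc.X + ((j : ℕ) : RatFunc ℚ))) = P at *
  generalize (∏ j ∈ Finset.range (j + 1),
      ((1 : RatFunc ℚ) - (N : RatFunc ℚ) + ((j : ℕ) : RatFunc ℚ))) = P2 at *
  generalize (∏ j ∈ Finset.range (j + 1), (RatFunc.X - ((j : ℕ) : RatFunc ℚ))) = P3 at *
  generalize (Nat.factorial (j + 1)) = f at *
  generalize (RatFunc.X : RatFunc ℚ) = t at *
  push_cast at *
  rw [pow_succ]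
  field_simp
  ring

lemma lastFactor_top (M : ℕ) (hM : 0 < M) :
    c (((M + 1 : ℕ) : RatFunc ℚ) + RatFunc.X) M M * lastFactor (M + 1) M = 1 := by
  obtain ⟨j, rfl⟩ : ∃ j, M = j + 1 := ⟨M - 1, by omega⟩
  unfold lastFactor c
  simp only [Nat.add_sub_cancel]
  rw [Finset.prod_div_distrib, Finset.prod_div_distrib]
  have e1 : ∏ i ∈ Finset.range j, ((i : RatFunc ℚ) + 1 - ((j + 1 : ℕ) : RatFunc ℚ)) =
      (-1) ^ j * (Nat.factorial j : RatFunc ℚ) := by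
    rw [← prod_sub_self]
    exact Finset.prod_congr rfl fun i _ => by push_cast; ring
  have e2 : ∏ i ∈ Finset.range j, ((i : RatFunc ℚ) + 1) = (Nat.factorial j : RatFunc ℚ) := by
    rw [← Finset.prod_range_add_one_eq_factorial]
    push_cast
    rfl
  have e3 : ∏ i ∈ Finset.range (j + 1), ((1 : RatFunc ℚ) - ((j + 1 + 1 : ℕ) : RatFunc ℚ) + (i : RatFunc ℚ))
      = (-1) ^ (j + 1) * (Nat.factorial (j + 1) : RatFunc ℚ) := by
    rw [← prod_sub_self]
    exact Finset.prod_congr rfl fun i _ => by push_cast; ring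
  have e4 : ∏ i ∈ Finset.range (j + 1),
      ((1 : RatFunc ℚ) - ((j + 1 + 1 : ℕ) : RatFunc ℚ) - RatFunc.X + (i : RatFunc ℚ))
      = (-1) ^ (j + 1) * ∏ i ∈ Finset.range (j + 1),
        (((j + 1 + 1 : ℕ) : RatFunc ℚ) + RatFunc.X - ((i : RatFunc ℚ) + 1)) := by
    have : ((-1 : RatFunc ℚ)) ^ (j + 1) = ∏ i ∈ Finset.range (j + 1), (-1 : RatFunc ℚ) := by simp
    rw [this, ← Finset.prod_mul_distrib]
    exact Finset.prod_congr rfl fun i _ => by push_cast; ring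
  have e5 : ∏ i ∈ Finset.range (j + 1),
        (((j + 1 + 1 : ℕ) : RatFunc ℚ) + RatFunc.X - ((i : RatFunc ℚ) + 1) - ((j + 1 : ℕ) : RatFunc ℚ))
      = ∏ i ∈ Finset.range (j + 1), (RatFunc.X - ((i : ℕ) : RatFunc ℚ)) :=
    Finset.prod_congr rfl fun i _ => by push_cast; ring
  rw [e1, e2, e3, e4, e5]
  have h1 : ∏ i ∈ Finset.range (j + 1), (RatFunc.X - ((i : ℕ) : RatFunc ℚ)) ≠ 0 := by
    refine Finset.prod_ne_zero_iff.2 fun i _ => ?_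
    have := X_add_int_ne (- i)
    push_cast at this
    rwa [sub_eq_add_neg]
  have h2 : ∏ i ∈ Finset.range (j + 1),
        (((j + 1 + 1 : ℕ) : RatFunc ℚ) + RatFunc.X - ((i : RatFunc ℚ) + 1)) ≠ 0 := by
    refine Finset.prod_ne_zero_iff.2 fun i _ => ?_
    have := X_add_int_ne (j + 1 + 1 - (i + 1))
    push_cast at this ⊢
    intro h
    apply this
    linear_combination h
  have hf : ((Nat.factorial (j + 1) : ℕ) : RatFunc ℚ) ≠ 0 := by
    exact_mod_cast Nat.factorial_ne_zero _
  have hf' : ((Nat.factorial j : ℕ) : RatFunc ℚ) ≠ 0 := by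
    exact_mod_cast Nat.factorial_ne_zero _
  generalize (∏ i ∈ Finset.range (j + 1), (RatFunc.X - ((i : ℕ) : RatFunc ℚ))) = P at *
  generalize (∏ i ∈ Finset.range (j + 1),
        (((j + 1 + 1 : ℕ) : RatFunc ℚ) + RatFunc.X - ((i : RatFunc ℚ) + 1))) = P2 at *
  generalize ((Nat.factorial (j + 1) : ℕ) : RatFunc ℚ) = f1 at *
  generalize ((Nat.factorial j : ℕ) : RatFunc ℚ) = f2 at *
  have hs : ((-1 : RatFunc ℚ) ^ j) * (-1) ^ j = 1 := by
    rw [← mul_pow]; simp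
  have hs0 : ((-1 : RatFunc ℚ) ^ (j + 1)) ≠ 0 := by simp
  generalize ((-1 : RatFunc ℚ) ^ (j + 1)) = s1 at *
  generalize ((-1 : RatFunc ℚ) ^ j) = s2 at *
  field_simp
  linear_combination hs

lemma prod_ite_z {r : ℕ} (P : Fin r → Prop) (f g : Fin r → RatFunc ℚ) {d : Decidable (∀ i, P i)}
    (h1 : ∀ i, P i → g i = f i) (h2 : ∀ i, ¬ P i → g i = 0) :
    (∏ i, g i) = if ∀ i, P i then ∏ i, f i else 0 := by
  by_cases h : ∀ i, P i
  · rw [if_pos h]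
    exact Finset.prod_congr rfl fun i _ => h1 i (h i)
  · rw [if_neg h]
    push Not at h
    obtain ⟨i, hi⟩ := h
    exact Finset.prod_eq_zero (Finset.mem_univ i) (h2 i hi)

lemma FNL_eq (N : ℕ) (k : List ℕ) :
    FNL N k = ∑ s, Zs (WF N ((N : RatFunc ℚ) + RatFunc.X)) (tF (RatFunc ℚ) N) (fun _ => 1) k s := by
  have key := sum_finset_states (K := RatFunc ℚ) k.length N
    (fun e n => Zs (WF N ((N : RatFunc ℚ) + RatFunc.X)) (tF (RatFunc ℚ) N) (fun _ => 1) k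
      (fun i => (e i, n i)))
  refine Eq.trans ?_ key
  unfold FNL
  refine Finset.sum_congr rfl fun A _ => ?_
  rw [Finset.mul_sum, Finset.sum_filter]
  refine Finset.sum_congr rfl fun n _ => ?_
  have hsign : (-1 : RatFunc ℚ) ^ A.card = ∏ i : Fin k.length, if i ∈ A then (-1 : RatFunc ℚ) else 1 := by
    simp [Finset.prod_ite]
  unfold Zs
  have e1 : (∏ i : Fin k.length, WF N ((N : RatFunc ℚ) + RatFunc.X) (k.get i) (decide (i ∈ A), n i)) =
      if ∀ i, 0 < (n i : ℕ) then (-1 : RatFunc ℚ) ^ A.card * ∏ i : Fin k.length,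
        (if i ∈ A then
          1 / ((N : RatFunc ℚ) - ((n i : ℕ) : RatFunc ℚ) + RatFunc.X) ^ k.get i
        else 1 / (((n i : ℕ) : RatFunc ℚ)) ^ k.get i) else 0 := by
    rw [hsign, ← Finset.prod_mul_distrib]
    refine prod_ite_z _ _ _ (fun i hp => ?_) (fun i hp => by simp [WF, hp])
    have : (N : RatFunc ℚ) + RatFunc.X - ((n i : ℕ) : RatFunc ℚ) =
      (N : RatFunc ℚ) - ((n i : ℕ) : RatFunc ℚ) + RatFunc.X := by ring
    by_cases hi : i ∈ A <;> simp [WF, hi, this, hp]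
  have e2 : (∏ i : Fin k.length, if h : (i : ℕ) + 1 < k.length then
      tF (RatFunc ℚ) N (decide (i ∈ A), n i) (decide ((⟨(i : ℕ) + 1, h⟩ : Fin k.length) ∈ A), n ⟨(i : ℕ) + 1, h⟩)
      else 1) = if (∀ (i : Fin k.length) (h : (i : ℕ) + 1 < k.length),
        if (⟨(i : ℕ) + 1, h⟩ : Fin k.length) ∈ A then n i < n ⟨(i : ℕ) + 1, h⟩
        else n i ≤ n ⟨(i : ℕ) + 1, h⟩) then ∏ i : Fin k.length, (1 : RatFunc ℚ) else 0 := by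
    refine prod_ite_z _ _ _ (fun i hp => ?_) (fun i hp => ?_)
    · by_cases h : (i : ℕ) + 1 < k.length
      · have := hp h
        simp [h, tF, this]
      · simp [h]
    · by_cases h : (i : ℕ) + 1 < k.length
      · have : ¬ (if (⟨(i : ℕ) + 1, h⟩ : Fin k.length) ∈ A then n i < n ⟨(i : ℕ) + 1, h⟩
            else n i ≤ n ⟨(i : ℕ) + 1, h⟩) := fun hq => hp fun _ => hq
        simp [h, tF, this]
      · exact absurd (fun h' => absurd h' h) hp
  rw [e1, e2, Finset.prod_const_one]
  by_cases h1 : ∀ i, 0 < (n i : ℕ)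
  · by_cases h2 : (∀ (i : Fin k.length) (h : (i : ℕ) + 1 < k.length),
        if (⟨(i : ℕ) + 1, h⟩ : Fin k.length) ∈ A then n i < n ⟨(i : ℕ) + 1, h⟩
        else n i ≤ n ⟨(i : ℕ) + 1, h⟩)
    · rw [if_pos ⟨h1, h2⟩, if_pos h1, if_pos h2, mul_one]
    · rw [if_neg (fun h => h2 h.2), if_neg h2, mul_zero]
  · rw [if_neg (fun h => h1 h.1), if_neg h1, zero_mul]

lemma GNL_eq (N : ℕ) (k : List ℕ) :
    GNL N k = ∑ s, Zs (WG N ((N : RatFunc ℚ) + RatFunc.X)) (tG (RatFunc ℚ) N)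
      (EG N (lastFactor N)) k s := by
  have key := sum_finset_states (K := RatFunc ℚ) k.length N
    (fun e n => Zs (WG N ((N : RatFunc ℚ) + RatFunc.X)) (tG (RatFunc ℚ) N) (EG N (lastFactor N)) k
      (fun i => (e i, n i)))
  refine Eq.trans ?_ key
  unfold GNL
  refine Finset.sum_congr rfl fun A _ => ?_
  rw [Finset.sum_filter]
  have e1 : ∀ n : Fin k.length → Fin N, (∏ i : Fin k.length,
      WG N ((N : RatFunc ℚ) + RatFunc.X) (k.get i) (decide (i ∈ A), n i)) =
      if ∀ i, (0 < (n i : ℕ) ∧ (i ∈ A → k.get i = 1)) then ∏ i : Fin k.length,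
        (if i ∈ A then
          1 / ((N : RatFunc ℚ) - ((n i : ℕ) : RatFunc ℚ) + RatFunc.X)
        else 1 / (((n i : ℕ) : RatFunc ℚ)) ^ k.get i) else 0 := by
    intro n
    refine prod_ite_z _ _ _ (fun i hp => ?_) (fun i hp => ?_)
    all_goals have : (N : RatFunc ℚ) + RatFunc.X - ((n i : ℕ) : RatFunc ℚ) =
      (N : RatFunc ℚ) - ((n i : ℕ) : RatFunc ℚ) + RatFunc.X := by ring
    · obtain ⟨h0, hp⟩ := hp
      by_cases hi : i ∈ A
      · have := hp hi
        simp_all [WG]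
      · simp [WG, hi, h0]
    · by_cases hi : i ∈ A <;> by_cases h0 : 0 < (n i : ℕ) <;> simp_all [WG]
  have e2 : ∀ n : Fin k.length → Fin N,
      (∏ i : Fin k.length, if h : (i : ℕ) + 1 < k.length then
      tG (RatFunc ℚ) N (decide (i ∈ A), n i) (decide ((⟨(i : ℕ) + 1, h⟩ : Fin k.length) ∈ A), n ⟨(i : ℕ) + 1, h⟩)
      else EG N (lastFactor N) (decide (i ∈ A), n i)) =
      if (∀ (i : Fin k.length), (i ∈ A → (i : ℕ) + 1 ≠ k.length) ∧ ∀ (h : (i : ℕ) + 1 < k.length),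
        if i ∉ A ∧ (⟨(i : ℕ) + 1, h⟩ : Fin k.length) ∈ A then n i < n ⟨(i : ℕ) + 1, h⟩
        else n i ≤ n ⟨(i : ℕ) + 1, h⟩) then (∏ i : Fin k.length,
          if (i : ℕ) + 1 = k.length then lastFactor N (n i : ℕ) else 1) else 0 := by
    intro n
    refine prod_ite_z _ _ _ (fun i hp => ?_) (fun i hp => ?_)
    · by_cases h : (i : ℕ) + 1 < k.length
      · have h' : (i : ℕ) + 1 ≠ k.length := h.ne
        have := hp.2 h
        simp [h, h', tG, this]
      · have h' : (i : ℕ) + 1 = k.length := by omega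
        have hi : i ∉ A := fun hi => hp.1 hi h'
        simp [h', EG, hi]
    · by_cases h : (i : ℕ) + 1 < k.length
      · have : ¬ (if i ∉ A ∧ (⟨(i : ℕ) + 1, h⟩ : Fin k.length) ∈ A then n i < n ⟨(i : ℕ) + 1, h⟩
            else n i ≤ n ⟨(i : ℕ) + 1, h⟩) := fun hq => hp ⟨fun _ => h.ne, fun _ => hq⟩
        simp [h, tG, this]
      · have h' : (i : ℕ) + 1 = k.length := by omega
        have hi : i ∈ A := by
          by_contra hi
          exact hp ⟨fun h => absurd h hi, fun h' => absurd h' h⟩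
        simp [h', EG, hi]
  by_cases hA : ∀ i ∈ A, k.get i = 1 ∧ (i : ℕ) + 1 ≠ k.length
  · rw [if_pos hA]
    refine Finset.sum_congr rfl fun n _ => ?_
    unfold Zs
    rw [e1, e2]
    by_cases h1 : ∀ i, 0 < (n i : ℕ)
    · rw [if_pos (c := ∀ i, (0 < (n i : ℕ) ∧ (i ∈ A → k.get i = 1)))
        (fun i => ⟨h1 i, fun h => (hA i h).1⟩)]
      by_cases h2 : (∀ (i : Fin k.length) (h : (i : ℕ) + 1 < k.length),
        if i ∉ A ∧ (⟨(i : ℕ) + 1, h⟩ : Fin k.length) ∈ A then n i < n ⟨(i : ℕ) + 1, h⟩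
        else n i ≤ n ⟨(i : ℕ) + 1, h⟩)
      · rw [if_pos ⟨h1, h2⟩, if_pos fun i => ⟨fun h => (hA i h).2, h2 i⟩]
      · rw [if_neg (fun h => h2 h.2), if_neg (fun h => h2 fun i => (h i).2), mul_zero]
    · rw [if_neg (fun h => h1 h.1), if_neg (fun h => h1 fun i => (h i).1), zero_mul]
  · rw [if_neg hA]
    symm
    refine Finset.sum_eq_zero fun n _ => ?_
    unfold Zs
    rw [e1, e2]
    push Not at hA
    obtain ⟨i, hi, h⟩ := hA
    by_cases h3 : k.get i = 1
    · exact mul_eq_zero_of_right _ (if_neg (fun h' => (h' i).1 hi (h h3)))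
    · exact mul_eq_zero_of_left (if_neg (fun h' => h3 ((h' i).2 hi))) _

end HD

/-- **Theorem (`F_N(k;t) = G_N(k^∨;t)`).** -/
theorem FN_eq_GN_dual (N : ℕ) (hNpos : 0 < N) (k l : List ℕ)
    (hdual : HoffmanDual k l) :
    FNL N k = GNL N l := by
  have hD : ∀ z : ℕ, ((N : RatFunc ℚ) + RatFunc.X) - (z : RatFunc ℚ) ≠ 0 := by
    intro z
    have := HD.X_add_int_ne ((N : ℤ) - z)
    push_cast at this
    intro h
    apply this
    linear_combination h
  have ht : ∀ z : ℕ, (RatFunc.X : RatFunc ℚ) - (z : RatFunc ℚ) ≠ 0 := by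
    intro z
    have := HD.X_add_int_ne (-(z : ℤ))
    push_cast at this
    rwa [sub_eq_add_neg]
  have hbase := HD.relBase N (RatFunc.X : RatFunc ℚ) ((N : RatFunc ℚ) + RatFunc.X) rfl hD
    (lastFactor N) (fun m hm => HD.lastFactor_step N m hm) ht (by
      intro hN
      obtain ⟨M, rfl⟩ : ∃ M, N = M + 1 := ⟨N - 1, by omega⟩
      exact HD.lastFactor_top M (by omega))
  rw [HD.FNL_eq, HD.GNL_eq]
  obtain ⟨h1, h2, h3, -⟩ := id hdual
  match k, l with
  | [], [] => simp [HD.Zs]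
  | [], b :: ls =>
    have := h2 b (by simp)
    simp at h3
    omega
  | a :: ks, [] =>
    have := h1 a (by simp)
    simp at h3
    omega
  | a :: ks, b :: ls => exact HD.total_eq N _ hD _ hbase a b ks ls hdual
end

section
/- Let N be a positive integer and let k=(k_1,…,k_r) and l=(l_1,…,l_s) be indices. Then the transport relations hold in ℚ(t): (i) Z_{N,t}(k_↑;l) = Z_{N,t}(k;←l), where k_↑ = (k_1,…,k_{r−1},k_r+1) and ←l = (1,l_1,…,l_s); (ii) Z_{N,t}(k_→;l) = Z_{N,t}(k;↑l), where k_→ = (k_1,…,k_r,1) and ↑l = (l_1+1,l_2,…,l_s); and (iii) Z_{N,t}(k_↑;∅) = Z_{N,t}(k;(1)), where (1) is the index of depth 1 with single entry 1. -/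
open scoped Classical

/-- The rising factorial `(a)_n = a(a+1)⋯(a+n-1)` in `ℚ(t)`. -/
noncomputable def rfac (a : RatFunc ℚ) (n : ℕ) : RatFunc ℚ :=
  ∏ j ∈ Finset.range n, (a + ((j : ℕ) : RatFunc ℚ))

/-- The connector `C_{N,t}(n,m)` (both arguments unflipped):
`C_{N,t}(n,m) = (-1)^{n-1}·n·binom(m,n)·(1-N-t)_{n+m}/((1-N-t)_n·(1-N-t)_m)`. -/
noncomputable def Cnn (N n m : ℕ) : RatFunc ℚ :=
  (-1 : RatFunc ℚ) ^ (n - 1) * (n : RatFunc ℚ) * ((Nat.choose m n : ℕ) : RatFunc ℚ) *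
    rfac (1 - (N : RatFunc ℚ) - RatFunc.X) (n + m) /
    (rfac (1 - (N : RatFunc ℚ) - RatFunc.X) n *
      rfac (1 - (N : RatFunc ℚ) - RatFunc.X) m)

/-- The connector `C_{N,t}(N-n+t, m)` (first argument flipped). -/
noncomputable def Cfn (N n m : ℕ) : RatFunc ℚ :=
  (((N : RatFunc ℚ) - (n : RatFunc ℚ) + RatFunc.X) /
      ((N : RatFunc ℚ) - (n : RatFunc ℚ) - (m : RatFunc ℚ) + RatFunc.X)) * Cnn N n m

/-- The connector `C_{N,t}(n, N-m+t)` (second argument flipped):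
`C_{N,t}(n, N-m+t) = C_{N,t}(n, m-1)` (in particular `C_{N,t}(n, N-1+t) = 0`). -/
noncomputable def Cnf (N n m : ℕ) : RatFunc ℚ := Cnn N n (m - 1)

/-- The connector `C_{N,t}(N-n+t, N-m+t)` (both arguments flipped). -/
noncomputable def Cff (N n m : ℕ) : RatFunc ℚ :=
  (((N : RatFunc ℚ) - (n : RatFunc ℚ) + RatFunc.X) *
      ((N : RatFunc ℚ) - (m : RatFunc ℚ) + RatFunc.X) /
      ((m : RatFunc ℚ) *
        ((N : RatFunc ℚ) - (n : RatFunc ℚ) - (m : RatFunc ℚ) + RatFunc.X))) * Cnn N n m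

/-- The connected sum `Z_{N,t}(k;l) ∈ ℚ(t)` of two (nonempty) indices `k`, `l`:
the sum over `A ⊂ [r]¹_k`, `B ⊂ [s]`, `(n₁,…,n_r) ∈ S⋆_{r,N}(A)` and
`(m₁,…,m_s) ∈ S̄_{s,N}(B)` of `(-1)^{#B}` times the connector `C_{N,t}(x,y)` (with
`x = N-n_r+t` if `r ∈ A`, `x = n_r` otherwise; `y = N-m₁+t` if `1 ∈ B`, `y = m₁`
otherwise) times `(∏_{i∈A} 1/(N-nᵢ+t))·(∏_{i∉A} 1/nᵢ^{kᵢ})·(∏_{j∈B} 1/(N-mⱼ+t)^{lⱼ})·(∏_{j∉B} 1/mⱼ^{lⱼ})`. -/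
noncomputable def Zcon (N : ℕ) (k l : List ℕ) : RatFunc ℚ :=
  ∑ A : Finset (Fin k.length), ∑ B : Finset (Fin l.length),
    if ∀ i ∈ A, k.get i = 1 then
      ∑ n ∈ Finset.univ.filter (fun n : Fin k.length → Fin N =>
          (∀ i, 0 < (n i : ℕ)) ∧
          ∀ (i : Fin k.length) (h : (i : ℕ) + 1 < k.length),
            if i ∉ A ∧ (⟨(i : ℕ) + 1, h⟩ : Fin k.length) ∈ A then
              n i < n ⟨(i : ℕ) + 1, h⟩
            else n i ≤ n ⟨(i : ℕ) + 1, h⟩),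
        ∑ m ∈ Finset.univ.filter (fun m : Fin l.length → Fin N =>
            (∀ j, 0 < (m j : ℕ)) ∧
            ∀ (j : Fin l.length) (h : (j : ℕ) + 1 < l.length),
              if (⟨(j : ℕ) + 1, h⟩ : Fin l.length) ∈ B then m j < m ⟨(j : ℕ) + 1, h⟩
              else m j ≤ m ⟨(j : ℕ) + 1, h⟩),
          (-1 : RatFunc ℚ) ^ B.card *
          (if hk : 0 < k.length then
            if hl : 0 < l.length then
              (if (⟨k.length - 1, Nat.sub_lt hk Nat.one_pos⟩ : Fin k.length) ∈ A then
                (if (⟨0, hl⟩ : Fin l.length) ∈ B then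
                  Cff N (n ⟨k.length - 1, Nat.sub_lt hk Nat.one_pos⟩ : ℕ) (m ⟨0, hl⟩ : ℕ)
                else
                  Cfn N (n ⟨k.length - 1, Nat.sub_lt hk Nat.one_pos⟩ : ℕ) (m ⟨0, hl⟩ : ℕ))
              else
                (if (⟨0, hl⟩ : Fin l.length) ∈ B then
                  Cnf N (n ⟨k.length - 1, Nat.sub_lt hk Nat.one_pos⟩ : ℕ) (m ⟨0, hl⟩ : ℕ)
                else
                  Cnn N (n ⟨k.length - 1, Nat.sub_lt hk Nat.one_pos⟩ : ℕ) (m ⟨0, hl⟩ : ℕ)))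
            else 0
          else 0) *
          (∏ i : Fin k.length,
            if i ∈ A then 1 / ((N : RatFunc ℚ) - ((n i : ℕ) : RatFunc ℚ) + RatFunc.X)
            else 1 / (((n i : ℕ) : RatFunc ℚ)) ^ k.get i) *
          (∏ j : Fin l.length,
            if j ∈ B then
              1 / ((N : RatFunc ℚ) - ((m j : ℕ) : RatFunc ℚ) + RatFunc.X) ^ l.get j
            else 1 / (((m j : ℕ) : RatFunc ℚ)) ^ l.get j)
    else 0

/-- The connected sum `Z_{N,t}(k_↑; ∅) ∈ ℚ(t)`, defined directly from `k`:
the sum over `A ⊂ [r]¹_k ∖ {r}` and `(n₁,…,n_r) ∈ S⋆_{r,N}(A)` of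
`C_{N,t}(n_r, N-1)·(∏_{i∈A} 1/(N-nᵢ+t))·(∏_{i∉A} 1/nᵢ^{kᵢ})·(1/n_r)`. -/
noncomputable def ZconUp (N : ℕ) (k : List ℕ) : RatFunc ℚ :=
  ∑ A : Finset (Fin k.length),
    if ∀ i ∈ A, k.get i = 1 ∧ (i : ℕ) + 1 ≠ k.length then
      ∑ n ∈ Finset.univ.filter (fun n : Fin k.length → Fin N =>
          (∀ i, 0 < (n i : ℕ)) ∧
          ∀ (i : Fin k.length) (h : (i : ℕ) + 1 < k.length),
            if i ∉ A ∧ (⟨(i : ℕ) + 1, h⟩ : Fin k.length) ∈ A then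
              n i < n ⟨(i : ℕ) + 1, h⟩
            else n i ≤ n ⟨(i : ℕ) + 1, h⟩),
        (if hk : 0 < k.length then
          Cnn N (n ⟨k.length - 1, Nat.sub_lt hk Nat.one_pos⟩ : ℕ) (N - 1) *
            (1 / (((n ⟨k.length - 1, Nat.sub_lt hk Nat.one_pos⟩ : ℕ) : ℕ) : RatFunc ℚ))
        else 0) *
        ∏ i : Fin k.length,
          if i ∈ A then 1 / ((N : RatFunc ℚ) - ((n i : ℕ) : RatFunc ℚ) + RatFunc.X)
          else 1 / (((n i : ℕ) : RatFunc ℚ)) ^ k.get i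
    else 0

/-- `k_↑ = (k₁, …, k_{r-1}, k_r + 1)`. -/
def upArrow (k : List ℕ) : List ℕ := k.dropLast ++ [k.getLastD 0 + 1]

/-- `↑l = (l₁ + 1, l₂, …, l_s)`. -/
def headUp : List ℕ → List ℕ
  | [] => []
  | a :: t => (a + 1) :: t


theorem u_ne (N : ℕ) (z : ℤ) : (N : RatFunc ℚ) + (RatFunc.X : RatFunc ℚ) - (z : RatFunc ℚ) ≠ 0 := by
  intro h
  have h1 : (algebraMap (Polynomial ℚ) (RatFunc ℚ)) (Polynomial.X + Polynomial.C ((N : ℚ) - z)) = 0 := by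
    rw [map_add, RatFunc.algebraMap_X, map_sub, map_sub]
    simp only [map_natCast, map_intCast]
    linear_combination h
  have h2 := (map_eq_zero_iff _ (RatFunc.algebraMap_injective ℚ)).1 h1
  exact Polynomial.X_add_C_ne_zero _ h2

theorem u_ne_nat (N a : ℕ) : (N : RatFunc ℚ) - (a : RatFunc ℚ) + (RatFunc.X : RatFunc ℚ) ≠ 0 := by
  have := u_ne N a
  intro h; apply this; push_cast; linear_combination h

theorem u_ne_nat2 (N a b : ℕ) :
    (N : RatFunc ℚ) - (a : RatFunc ℚ) - (b : RatFunc ℚ) + (RatFunc.X : RatFunc ℚ) ≠ 0 := by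
  have := u_ne N (a + b)
  intro h; apply this; push_cast; linear_combination h

theorem rf_term_ne (N j : ℕ) : (1 - (N : RatFunc ℚ) - (RatFunc.X : RatFunc ℚ)) + (j : RatFunc ℚ) ≠ 0 := by
  have := u_ne N (1 + j)
  intro h; apply this; push_cast; linear_combination -h

theorem rfac_ne (N n : ℕ) : rfac (1 - (N : RatFunc ℚ) - (RatFunc.X : RatFunc ℚ)) n ≠ 0 := by
  unfold rfac
  exact Finset.prod_ne_zero_iff.2 fun j _ => rf_term_ne N j

theorem rfac_succ (a : RatFunc ℚ) (n : ℕ) : rfac a (n + 1) = rfac a n * (a + n) := by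
  unfold rfac; rw [Finset.prod_range_succ]

theorem choose_cast_right (m n : ℕ) :
    ((m.choose (n + 1) : ℕ) : RatFunc ℚ) * (n + 1) = (m.choose n : ℕ) * ((m : RatFunc ℚ) - n) := by
  rcases le_or_gt n m with h | h
  · have := Nat.choose_succ_right_eq m n
    have h2 := congrArg (Nat.cast : ℕ → RatFunc ℚ) this
    push_cast [Nat.cast_sub h] at h2
    exact h2
  · rw [Nat.choose_eq_zero_of_lt h, Nat.choose_eq_zero_of_lt (by omega)]; simp

theorem choose_cast_up (m n : ℕ) :
    ((m.choose n : ℕ) : RatFunc ℚ) * (m + 1) =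
      ((m + 1).choose n : ℕ) * ((m : RatFunc ℚ) + 1 - n) := by
  rcases le_or_gt n (m + 1) with h | h
  · have := Nat.choose_mul_succ_eq m n
    have h2 := congrArg (Nat.cast : ℕ → RatFunc ℚ) this
    push_cast [Nat.cast_sub h] at h2
    exact h2
  · rw [Nat.choose_eq_zero_of_lt h, Nat.choose_eq_zero_of_lt (by omega)]; simp

theorem Cnn_zero_of_lt (N n m : ℕ) (h : m < n) : Cnn N n m = 0 := by
  unfold Cnn; rw [Nat.choose_eq_zero_of_lt h]; simp

/-- recurrence in the second argument -/
theorem Cnn_up (N n m : ℕ) :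
    Cnn N n (m + 1) * ((m : RatFunc ℚ) + 1 - n) * ((m : RatFunc ℚ) + 1 - N - (RatFunc.X : RatFunc ℚ)) =
      Cnn N n m * (m + 1) * ((n : RatFunc ℚ) + m + 1 - N - (RatFunc.X : RatFunc ℚ)) := by
  have h1 := rfac_ne N n
  have h2 := rfac_ne N m
  have h3 := rf_term_ne N m
  have hc := choose_cast_up m n
  unfold Cnn
  rw [← add_assoc, rfac_succ, rfac_succ]
  generalize rfac (1 - (N : RatFunc ℚ) - (RatFunc.X : RatFunc ℚ)) n = A at *
  generalize rfac (1 - (N : RatFunc ℚ) - (RatFunc.X : RatFunc ℚ)) m = B at *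
  generalize rfac (1 - (N : RatFunc ℚ) - (RatFunc.X : RatFunc ℚ)) (n + m) = D at *
  rw [div_mul_eq_mul_div, div_mul_eq_mul_div, div_mul_eq_mul_div, div_mul_eq_mul_div,
    div_eq_div_iff (mul_ne_zero h1 (mul_ne_zero h2 h3)) (mul_ne_zero h1 h2)]
  push_cast
  linear_combination (-(-1) ^ (n - 1) * (n : RatFunc ℚ) * D * (n + m + 1 - N - (RatFunc.X : RatFunc ℚ)) * A * B *
    ((m : RatFunc ℚ) + 1 - N - (RatFunc.X : RatFunc ℚ))) * hc

/-- recurrence in the first argument -/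
theorem Cnn_right (N n m : ℕ) (hn : 0 < n) :
    Cnn N (n + 1) m * n * ((n : RatFunc ℚ) + 1 - N - (RatFunc.X : RatFunc ℚ)) =
      -Cnn N n m * ((m : RatFunc ℚ) - n) * ((n : RatFunc ℚ) + m + 1 - N - (RatFunc.X : RatFunc ℚ)) := by
  have h1 := rfac_ne N n
  have h2 := rfac_ne N m
  have h3 := rf_term_ne N n
  have hc := choose_cast_right m n
  obtain ⟨n, rfl⟩ : ∃ k, n = k + 1 := ⟨n - 1, by omega⟩
  unfold Cnn
  rw [show n + 1 + 1 + m = n + 1 + m + 1 by ring, rfac_succ _ (n + 1 + m), rfac_succ _ (n + 1),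
    Nat.add_sub_cancel, Nat.add_sub_cancel, pow_succ]
  generalize rfac (1 - (N : RatFunc ℚ) - (RatFunc.X : RatFunc ℚ)) (n + 1) = A at *
  generalize rfac (1 - (N : RatFunc ℚ) - (RatFunc.X : RatFunc ℚ)) m = B at *
  generalize rfac (1 - (N : RatFunc ℚ) - (RatFunc.X : RatFunc ℚ)) (n + 1 + m) = D at *
  rw [← neg_div, div_mul_eq_mul_div, div_mul_eq_mul_div, div_mul_eq_mul_div, div_mul_eq_mul_div,
    div_eq_div_iff (mul_ne_zero (mul_ne_zero h1 h3) h2) (mul_ne_zero h1 h2)]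
  push_cast at hc ⊢
  linear_combination (-(-1) ^ n * ((n : RatFunc ℚ) + 1) * D * (n + 1 + m + 1 - N - (RatFunc.X : RatFunc ℚ)) *
    A * B * ((n : RatFunc ℚ) + 1 + 1 - N - (RatFunc.X : RatFunc ℚ))) * hc

/-- (i), unflipped first argument -/
theorem tele_up (N n m : ℕ) (hn : 0 < n) (hm : 0 < m) :
    Cnn N n m * (1 / (m : RatFunc ℚ)) - Cnf N n m * (1 / ((N : RatFunc ℚ) - m + (RatFunc.X : RatFunc ℚ))) =
      Cnn N n m / n - Cnn N n (m - 1) / n := by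
  obtain ⟨m, rfl⟩ : ∃ k, m = k + 1 := ⟨m - 1, by omega⟩
  have h := Cnn_up N n m
  have h1 : (n : RatFunc ℚ) ≠ 0 := by exact_mod_cast hn.ne'
  have h2 : ((m + 1 : ℕ) : RatFunc ℚ) ≠ 0 := by exact_mod_cast hm.ne'
  have h3 := u_ne_nat N (m + 1)
  unfold Cnf
  rw [Nat.add_sub_cancel]
  push_cast at h2 h3 ⊢
  field_simp
  linear_combination h

theorem flip_up (N n m : ℕ) (hm : 0 < m) :
    Cfn N n m * (1 / (m : RatFunc ℚ)) - Cff N n m * (1 / ((N : RatFunc ℚ) - m + (RatFunc.X : RatFunc ℚ))) = 0 := by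
  have h2 : (m : RatFunc ℚ) ≠ 0 := by exact_mod_cast hm.ne'
  have h3 := u_ne_nat N m
  have h4 := u_ne_nat2 N n m
  unfold Cfn Cff
  field_simp
  ring

theorem tele_right_n (N n m : ℕ) (hn : 0 < n) (hm : 0 < m) :
    Cnn N n m * (1 / (m : RatFunc ℚ)) - Cnn N (n + 1) m * (1 / (m : RatFunc ℚ)) =
      Cnn N n m * (1 / (n : RatFunc ℚ)) +
        Cfn N (n + 1) m * (1 / ((N : RatFunc ℚ) - (n + 1 : ℕ) + (RatFunc.X : RatFunc ℚ))) := by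
  have h := Cnn_right N n m hn
  have h1 : (n : RatFunc ℚ) ≠ 0 := by exact_mod_cast hn.ne'
  have h2 : (m : RatFunc ℚ) ≠ 0 := by exact_mod_cast hm.ne'
  have h3 := u_ne_nat N (n + 1)
  have h4 := u_ne_nat2 N (n + 1) m
  unfold Cfn
  push_cast at h3 h4 ⊢
  field_simp
  linear_combination h

theorem last_right_n (N n m : ℕ) (hm : 0 < m) :
    Cnn N n m * (1 / (m : RatFunc ℚ)) +
      Cfn N n m * (1 / ((N : RatFunc ℚ) - n + (RatFunc.X : RatFunc ℚ))) = Cfn N n m * (1 / (m : RatFunc ℚ)) := by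
  have h2 : (m : RatFunc ℚ) ≠ 0 := by exact_mod_cast hm.ne'
  have h3 := u_ne_nat N n
  have h4 := u_ne_nat2 N n m
  unfold Cfn
  field_simp
  ring

theorem tele_right_f (N n m : ℕ) (hn : 0 < n) (hm : 0 < m) :
    Cnf N n m * (1 / ((N : RatFunc ℚ) - m + (RatFunc.X : RatFunc ℚ))) -
        Cnf N (n + 1) m * (1 / ((N : RatFunc ℚ) - m + (RatFunc.X : RatFunc ℚ))) =
      Cnf N n m * (1 / (n : RatFunc ℚ)) +
        Cff N (n + 1) m * (1 / ((N : RatFunc ℚ) - (n + 1 : ℕ) + (RatFunc.X : RatFunc ℚ))) := by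
  obtain ⟨m, rfl⟩ : ∃ k, m = k + 1 := ⟨m - 1, by omega⟩
  have h := Cnn_right N n m hn
  have hcright := Cnn_right N n (m + 1) hn
  have hcup := Cnn_up N n m
  have h1 : (n : RatFunc ℚ) ≠ 0 := by exact_mod_cast hn.ne'
  have h2 : ((m + 1 : ℕ) : RatFunc ℚ) ≠ 0 := by exact_mod_cast hm.ne'
  have h3 := u_ne_nat N (n + 1)
  have h4 := u_ne_nat2 N (n + 1) (m + 1)
  have h5 := u_ne_nat N (m + 1)
  unfold Cff Cnf
  rw [Nat.add_sub_cancel]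
  push_cast at h2 h3 h4 h5 h hcright hcup ⊢
  have e1 : Cnn N (n + 1) m = -Cnn N n m * ((m : RatFunc ℚ) - n) *
      ((N : RatFunc ℚ) + (RatFunc.X : RatFunc ℚ) - n - m - 1) / (n * (N - (n + 1) + (RatFunc.X : RatFunc ℚ))) := by
    rw [eq_div_iff (mul_ne_zero h1 h3)]; linear_combination -h
  have e2 : Cnn N (n + 1) (m + 1) = -Cnn N n m * ((m : RatFunc ℚ) + 1) *
      ((N : RatFunc ℚ) + (RatFunc.X : RatFunc ℚ) - n - m - 1) * (N - (n + 1) - (m + 1) + (RatFunc.X : RatFunc ℚ)) /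
      (n * (N - (n + 1) + (RatFunc.X : RatFunc ℚ)) * (N - (m + 1) + (RatFunc.X : RatFunc ℚ))) := by
    rw [eq_div_iff (mul_ne_zero (mul_ne_zero h1 h3) h5)]
    linear_combination (((m : RatFunc ℚ) + 1 - N - (RatFunc.X : RatFunc ℚ))) * hcright -
      ((n : RatFunc ℚ) + m + 2 - N - (RatFunc.X : RatFunc ℚ)) * hcup
  rw [e1, e2]
  field_simp
  ring

theorem last_right_f (N n m : ℕ) (hm : 0 < m) :
    Cnf N n m * (1 / ((N : RatFunc ℚ) - m + (RatFunc.X : RatFunc ℚ))) +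
      Cff N n m * (1 / ((N : RatFunc ℚ) - n + (RatFunc.X : RatFunc ℚ))) =
        Cff N n m * (1 / ((N : RatFunc ℚ) - m + (RatFunc.X : RatFunc ℚ))) := by
  obtain ⟨m, rfl⟩ : ∃ k, m = k + 1 := ⟨m - 1, by omega⟩
  have hcup := Cnn_up N n m
  have h2 : ((m + 1 : ℕ) : RatFunc ℚ) ≠ 0 := by exact_mod_cast hm.ne'
  have h3 := u_ne_nat N n
  have h4 := u_ne_nat2 N n (m + 1)
  have h5 := u_ne_nat N (m + 1)
  unfold Cff Cnf
  rw [Nat.add_sub_cancel]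
  push_cast at h2 h3 h4 h5 ⊢
  field_simp
  linear_combination hcup

/-- weight of one vertex on the left -/
noncomputable def wL (N : ℕ) (k : ℕ) (x : Bool × Fin N) : RatFunc ℚ :=
  if 0 < (x.2 : ℕ) then
    (if x.1 = true → k = 1 then
      (if x.1 = true then 1 / ((N : RatFunc ℚ) - ((x.2 : ℕ) : RatFunc ℚ) + (RatFunc.X : RatFunc ℚ))
        else 1 / (((x.2 : ℕ) : RatFunc ℚ)) ^ k)
    else 0)
  else 0

/-- edge condition on the left -/
noncomputable def cL (N : ℕ) (x y : Bool × Fin N) : RatFunc ℚ :=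
  if (if ¬ x.1 = true ∧ y.1 = true then x.2 < y.2 else x.2 ≤ y.2) then 1 else 0

/-- weight of one vertex on the right -/
noncomputable def wR (N : ℕ) (k : ℕ) (x : Bool × Fin N) : RatFunc ℚ :=
  if 0 < (x.2 : ℕ) then
    (if x.1 = true then -1 else 1) *
    (if x.1 = true then
        1 / ((N : RatFunc ℚ) - ((x.2 : ℕ) : RatFunc ℚ) + (RatFunc.X : RatFunc ℚ)) ^ k
      else 1 / (((x.2 : ℕ) : RatFunc ℚ)) ^ k)
  else 0

/-- edge condition on the right -/
noncomputable def cR (N : ℕ) (x y : Bool × Fin N) : RatFunc ℚ :=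
  if (if y.1 = true then x.2 < y.2 else x.2 ≤ y.2) then 1 else 0

/-- the connector -/
noncomputable def ConN (N : ℕ) (x y : Bool × Fin N) : RatFunc ℚ :=
  if x.1 = true then
    (if y.1 = true then Cff N x.2 y.2 else Cfn N x.2 y.2)
  else (if y.1 = true then Cnf N x.2 y.2 else Cnn N x.2 y.2)

/-- left transfer sum -/
noncomputable def TL (N r : ℕ) (f : Fin (r + 1) → ℕ) (φ : Bool × Fin N → RatFunc ℚ) : RatFunc ℚ :=
  ∑ p : Fin (r + 1) → Bool × Fin N,
    (∏ i, wL N (f i) (p i)) * (∏ i : Fin r, cL N (p i.castSucc) (p i.succ)) * φ (p (Fin.last r))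

/-- right transfer sum -/
noncomputable def TR (N s : ℕ) (g : Fin (s + 1) → ℕ) (φ : Bool × Fin N → RatFunc ℚ) : RatFunc ℚ :=
  ∑ q : Fin (s + 1) → Bool × Fin N,
    (∏ i, wR N (g i) (q i)) * (∏ i : Fin s, cR N (q i.castSucc) (q i.succ)) * φ (q 0)

theorem TL_snoc (N r : ℕ) (f : Fin (r + 1) → ℕ) (a : ℕ) (F : Fin (r + 2) → ℕ)
    (hF : ∀ i : Fin (r + 1), F i.castSucc = f i) (ha : F (Fin.last (r + 1)) = a)
    (φ : Bool × Fin N → RatFunc ℚ) :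
    TL N (r + 1) F φ = TL N r f (fun x => ∑ y, cL N x y * wL N a y * φ y) := by
  unfold TL
  rw [← (Fin.snocEquiv (fun _ : Fin (r + 2) => Bool × Fin N)).sum_comp, Fintype.sum_prod_type,
    Finset.sum_comm]
  refine Finset.sum_congr rfl fun p _ => ?_
  rw [Finset.mul_sum]
  refine Finset.sum_congr rfl fun y _ => ?_
  have e1 : ∏ i : Fin (r + 1), cL N (Fin.snoc (α := fun _ => Bool × Fin N) p y i.castSucc)
      (Fin.snoc (α := fun _ => Bool × Fin N) p y i.succ) =
      (∏ i : Fin r, cL N (p i.castSucc) (p i.succ)) * cL N (p (Fin.last r)) y := by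
    rw [Fin.prod_univ_castSucc]
    simp only [Fin.snoc_castSucc, Fin.snoc_last, Fin.succ_last, Fin.succ_castSucc]
  have e2 : ∏ i : Fin (r + 2), wL N (F i) (Fin.snoc (α := fun _ => Bool × Fin N) p y i) =
      (∏ i : Fin (r + 1), wL N (f i) (p i)) * wL N a y := by
    rw [Fin.prod_univ_castSucc]
    simp only [Fin.snoc_castSucc, Fin.snoc_last, hF, ha]
  simp only [Fin.snocEquiv_apply, e1, e2, Fin.snoc_last]
  ring

theorem TR_cons (N s : ℕ) (g : Fin (s + 1) → ℕ) (b : ℕ) (G : Fin (s + 2) → ℕ)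
    (hG : ∀ i : Fin (s + 1), G i.succ = g i) (hb : G 0 = b)
    (φ : Bool × Fin N → RatFunc ℚ) :
    TR N (s + 1) G φ = TR N s g (fun z => ∑ y, cR N y z * wR N b y * φ y) := by
  unfold TR
  rw [← (Fin.consEquiv (fun _ : Fin (s + 2) => Bool × Fin N)).sum_comp, Fintype.sum_prod_type,
    Finset.sum_comm]
  refine Finset.sum_congr rfl fun p _ => ?_
  rw [Finset.mul_sum]
  refine Finset.sum_congr rfl fun y _ => ?_
  have e1 : ∏ i : Fin (s + 1), cR N (Fin.cons (α := fun _ => Bool × Fin N) y p i.castSucc)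
      (Fin.cons (α := fun _ => Bool × Fin N) y p i.succ) =
      cR N y (p 0) * (∏ i : Fin s, cR N (p i.castSucc) (p i.succ)) := by
    rw [Fin.prod_univ_succ]
    simp only [Fin.cons_succ, Fin.cons_zero, Fin.castSucc_zero, ← Fin.succ_castSucc]
  have e2 : ∏ i : Fin (s + 2), wR N (G i) (Fin.cons (α := fun _ => Bool × Fin N) y p i) =
      wR N b y * (∏ i : Fin (s + 1), wR N (g i) (p i)) := by
    rw [Fin.prod_univ_succ]
    simp only [Fin.cons_succ, Fin.cons_zero, hG, hb]
  simp only [Fin.consEquiv_apply, e1, e2, Fin.cons_zero]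
  ring

theorem TL_congr (N r : ℕ) (f f' : Fin (r + 1) → ℕ) (φ ψ : Bool × Fin N → RatFunc ℚ)
    (hf : ∀ i : Fin r, f i.castSucc = f' i.castSucc)
    (h : ∀ x, wL N (f (Fin.last r)) x * φ x = wL N (f' (Fin.last r)) x * ψ x) :
    TL N r f φ = TL N r f' ψ := by
  unfold TL
  refine Finset.sum_congr rfl fun p _ => ?_
  rw [Fin.prod_univ_castSucc, Fin.prod_univ_castSucc (f := fun i => wL N (f' i) (p i))]
  simp only [hf]
  linear_combination ((∏ i : Fin r, wL N (f' i.castSucc) (p i.castSucc)) *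
    ∏ i : Fin r, cL N (p i.castSucc) (p i.succ)) * h (p (Fin.last r))

theorem TR_congr (N s : ℕ) (g g' : Fin (s + 1) → ℕ) (φ ψ : Bool × Fin N → RatFunc ℚ)
    (hg : ∀ i : Fin s, g i.succ = g' i.succ)
    (h : ∀ x, wR N (g 0) x * φ x = wR N (g' 0) x * ψ x) :
    TR N s g φ = TR N s g' ψ := by
  unfold TR
  refine Finset.sum_congr rfl fun p _ => ?_
  rw [Fin.prod_univ_succ, Fin.prod_univ_succ (f := fun i => wR N (g' i) (p i))]
  simp only [hg]
  linear_combination ((∏ i : Fin s, wR N (g' i.succ) (p i.succ)) *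
    ∏ i : Fin s, cR N (p i.castSucc) (p i.succ)) * h (p 0)

theorem TR_smul (N s : ℕ) (g : Fin (s + 1) → ℕ) (c : RatFunc ℚ) (φ : Bool × Fin N → RatFunc ℚ) :
    c * TR N s g φ = TR N s g (fun z => c * φ z) := by
  unfold TR
  rw [Finset.mul_sum]
  exact Finset.sum_congr rfl fun p _ => by ring

theorem TR_sum (N s : ℕ) (g : Fin (s + 1) → ℕ) {ι : Type} (t : Finset ι)
    (φ : ι → Bool × Fin N → RatFunc ℚ) :
    ∑ y ∈ t, TR N s g (φ y) = TR N s g (fun z => ∑ y ∈ t, φ y z) := by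
  unfold TR
  rw [Finset.sum_comm]
  exact Finset.sum_congr rfl fun p _ => by rw [Finset.mul_sum]

theorem TR_one (N : ℕ) (g : Fin 1 → ℕ) (φ : Bool × Fin N → RatFunc ℚ) :
    TR N 0 g φ = ∑ y, wR N (g 0) y * φ y := by
  unfold TR
  rw [← (Equiv.funUnique (Fin 1) (Bool × Fin N)).symm.sum_comp]
  simp

theorem sum_fin_tele (N M : ℕ) (hM : M < N) (F : ℕ → RatFunc ℚ) :
    ∑ n : Fin N, (if 0 < (n : ℕ) ∧ (n : ℕ) ≤ M then F n - F ((n : ℕ) - 1) else 0) = F M - F 0 := by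
  rw [Fin.sum_univ_eq_sum_range (fun n => if 0 < n ∧ n ≤ M then F n - F (n - 1) else 0),
    ← Finset.sum_filter]
  have : (Finset.range N).filter (fun n => 0 < n ∧ n ≤ M) = Finset.Ico 1 (M + 1) := by
    ext n; simp; omega
  rw [this, Finset.sum_Ico_eq_sum_range, ← Finset.sum_range_sub]
  simp [add_comm]

theorem sum_fin_Ico (N M : ℕ) (hM : 0 < M) (F : ℕ → RatFunc ℚ) :
    ∑ n : Fin N, (if 0 < (n : ℕ) ∧ M ≤ (n : ℕ) then F n else 0) = ∑ n ∈ Finset.Ico M N, F n := by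
  rw [Fin.sum_univ_eq_sum_range (fun n => if 0 < n ∧ M ≤ n then F n else 0),
    ← Finset.sum_filter]
  congr 1
  ext n; simp; omega

theorem sum_two (N n : ℕ) (hn : 0 < n) (hnN : n < N) (D G H : ℕ → RatFunc ℚ) (hD : D N = 0)
    (hH : H N = 0)
    (h : ∀ j, 0 < j → D j - D (j + 1) = G j + H (j + 1)) :
    ∑ j ∈ Finset.Ico n N, G j + ∑ j ∈ Finset.Ico (n + 1) N, H j = D n := by
  have hh : ∀ m, n ≤ m →
      ∑ j ∈ Finset.Ico n m, G j + ∑ j ∈ Finset.Ico (n + 1) (m + 1), H j = D n - D m := by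
    intro m hm
    induction m, hm using Nat.le_induction with
    | base => simp
    | succ m hm ih =>
      rw [Finset.sum_Ico_succ_top hm, Finset.sum_Ico_succ_top (by omega : n + 1 ≤ m + 1)]
      linear_combination ih - h m (by omega)
  have h1 := hh N hnN.le
  rw [Finset.sum_Ico_succ_top (by omega : n + 1 ≤ N), hH, hD] at h1
  linear_combination h1

theorem sum_up_false (N : ℕ) (x z : Bool × Fin N) (hx : 0 < (x.2 : ℕ)) (hz : 0 < (z.2 : ℕ))
    (h : x.1 = false) :
    ∑ y, cR N y z * wR N 1 y * ConN N x y = ConN N x z / ((x.2 : ℕ) : RatFunc ℚ) := by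
  obtain ⟨b, n⟩ := x
  obtain ⟨c, m⟩ := z
  simp only at hx hz h
  subst h
  have key : ∀ M : ℕ, M < N → ∑ y : Fin N, (if 0 < (y : ℕ) ∧ (y : ℕ) ≤ M then
      Cnn N n y * (1 / ((y : ℕ) : RatFunc ℚ)) -
        Cnf N n y * (1 / ((N : RatFunc ℚ) - ((y : ℕ) : RatFunc ℚ) + (RatFunc.X : RatFunc ℚ))) else 0) =
      Cnn N n M / ((n : ℕ) : RatFunc ℚ) := by
    intro M hM
    have := sum_fin_tele N M hM (fun j => Cnn N n j / ((n : ℕ) : RatFunc ℚ))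
    simp only [Cnn_zero_of_lt N n 0 hx, zero_div, sub_zero] at this
    rw [← this]
    refine Finset.sum_congr rfl fun y _ => ?_
    split_ifs with hy
    · exact tele_up N n y hx hy.1
    · rfl
  have gen : ∀ M : ℕ, (∀ y : Fin N, (if c = true then y < m else y ≤ m) ↔ (y : ℕ) ≤ M) → M < N →
      ∑ y, cR N y (c, m) * wR N 1 y * ConN N (false, n) y = Cnn N n M / ((n : ℕ) : RatFunc ℚ) := by
    intro M hM hMN
    rw [← key M hMN, Fintype.sum_prod_type, Fintype.sum_bool, ← Finset.sum_add_distrib]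
    refine Finset.sum_congr rfl fun y _ => ?_
    have hM' : ∀ b : Bool, cR N (b, y) (c, m) = if (y : ℕ) ≤ M then 1 else 0 := by
      intro b
      unfold cR
      exact if_congr (hM y) rfl rfl
    rw [hM', hM']
    simp only [wR, ConN]
    by_cases h1 : 0 < (y : ℕ) <;> by_cases h2 : (y : ℕ) ≤ M <;> simp [h1, h2]
    ring
  cases c
  · rw [gen (m : ℕ) (fun y => by simp only [Bool.false_eq_true, if_false, Fin.le_def]) m.2]; simp [ConN]
  · rw [gen ((m : ℕ) - 1) (fun y => by simp only [if_true, Fin.lt_def]; omega) (by omega)]; simp [ConN, Cnf]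

theorem sum_up_true (N : ℕ) (x z : Bool × Fin N) (h : x.1 = true) :
    ∑ y, cR N y z * wR N 1 y * ConN N x y = 0 := by
  obtain ⟨b, n⟩ := x
  simp only at h
  subst h
  rw [Fintype.sum_prod_type, Fintype.sum_bool, ← Finset.sum_add_distrib]
  refine Finset.sum_eq_zero fun y _ => ?_
  have hc : cR N (true, y) z = cR N (false, y) z := rfl
  rw [hc]
  by_cases h1 : 0 < (y : ℕ)
  · have := flip_up N n y h1
    simp only [wR, ConN, h1]
    simp
    linear_combination (cR N (false, y) z) * this
  · simp [wR, h1]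

theorem sum_top_false (N : ℕ) (x : Bool × Fin N) (hx : 0 < (x.2 : ℕ)) (h : x.1 = false) :
    ∑ y, wR N 1 y * ConN N x y = Cnn N x.2 (N - 1) / ((x.2 : ℕ) : RatFunc ℚ) := by
  have hN : 0 < N := x.2.pos
  have hN1 : 0 < N - 1 := by have := x.2.2; omega
  have := sum_up_false N x (false, ⟨N - 1, by omega⟩) hx hN1 h
  simp only [ConN, h] at this
  simp at this
  rw [← this]
  refine Finset.sum_congr rfl fun y _ => ?_
  have hc : cR N y (false, ⟨N - 1, by omega⟩) = 1 := by
    have : (y.2 : ℕ) ≤ N - 1 := by have := y.2.2; omega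
    simp [cR, Fin.le_def, this]
  rw [hc]; simp [ConN, h]

theorem sum_top_true (N : ℕ) (x : Bool × Fin N) (h : x.1 = true) :
    ∑ y, wR N 1 y * ConN N x y = 0 := by
  have hN : 0 < N := x.2.pos
  rw [← sum_up_true N x (false, ⟨N - 1, by omega⟩) h]
  refine Finset.sum_congr rfl fun y _ => ?_
  have hc : cR N y (false, ⟨N - 1, by omega⟩) = 1 := by
    have : (y.2 : ℕ) ≤ N - 1 := by have := y.2.2; omega
    simp [cR, Fin.le_def, this]
  rw [hc]; simp

/-- the value attached to a right vertex -/
noncomputable def valR (N : ℕ) (z : Bool × Fin N) : RatFunc ℚ :=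
  if z.1 = true then ((N : RatFunc ℚ) - ((z.2 : ℕ) : RatFunc ℚ) + (RatFunc.X : RatFunc ℚ))
  else ((z.2 : ℕ) : RatFunc ℚ)

theorem wR_succ (N b : ℕ) (z : Bool × Fin N) : wR N (b + 1) z = wR N b z * (1 / valR N z) := by
  unfold wR valR
  split_ifs <;> simp [pow_succ, mul_comm]

theorem sum_right (N : ℕ) (x z : Bool × Fin N) (hx : 0 < (x.2 : ℕ)) (hz : 0 < (z.2 : ℕ)) :
    ∑ y, cL N x y * wL N 1 y * ConN N y z = ConN N x z * (1 / valR N z) := by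
  obtain ⟨a, n⟩ := x
  obtain ⟨c, m⟩ := z
  simp only at hx hz
  -- the two summands as functions on ℕ
  let G : ℕ → RatFunc ℚ := fun j =>
    (if c = true then Cnf N j m else Cnn N j m) * (1 / (j : RatFunc ℚ))
  let H : ℕ → RatFunc ℚ := fun j =>
    (if c = true then Cff N j m else Cfn N j m) *
      (1 / ((N : RatFunc ℚ) - (j : RatFunc ℚ) + (RatFunc.X : RatFunc ℚ)))
  let D : ℕ → RatFunc ℚ := fun j =>
    (if c = true then Cnf N j m else Cnn N j m) * (1 / valR N (c, m))
  have hmN := m.2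
  have z1 : Cnn N N m = 0 := Cnn_zero_of_lt _ _ _ hmN
  have z2 : Cnn N N (m - 1) = 0 := Cnn_zero_of_lt _ _ _ (by omega)
  have hD : D N = 0 := by simp only [D]; split_ifs <;> simp [Cnf, z1, z2]
  have hH : H N = 0 := by simp only [H]; split_ifs <;> simp [Cff, Cfn, z1]
  have hst : ∀ j, 0 < j → D j - D (j + 1) = G j + H (j + 1) := by
    intro j hj
    simp only [D, G, H, valR]
    split_ifs
    · exact tele_right_f N j m hj hz
    · exact tele_right_n N j m hj hz
  have main := sum_two N n hx n.2 D G H hD hH hst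
  have split : ∑ y, cL N (a, n) y * wL N 1 y * ConN N y (c, m) =
      ∑ y ∈ Finset.Ico (n : ℕ) N, G y +
        ∑ y ∈ Finset.Ico (if a = true then (n : ℕ) else n + 1) N, H y := by
    rw [← sum_fin_Ico N n hx, ← sum_fin_Ico N _ (by split_ifs <;> omega),
      Fintype.sum_prod_type, Fintype.sum_bool, add_comm]
    congr 1
    · refine Finset.sum_congr rfl fun y _ => ?_
      simp only [cL, wL, ConN, G, Fin.le_def]
      by_cases h1 : 0 < (y : ℕ) <;> by_cases h2 : (n : ℕ) ≤ y <;> simp [h1, h2]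
      ring
    · refine Finset.sum_congr rfl fun y _ => ?_
      simp only [cL, wL, ConN, H, Fin.le_def, Fin.lt_def]
      cases a
      · by_cases h1 : 0 < (y : ℕ) <;> by_cases h2 : (n : ℕ) < y <;> simp [h1, h2]
        ring
      · by_cases h1 : 0 < (y : ℕ) <;> by_cases h2 : (n : ℕ) ≤ y <;> simp [h1, h2]
        ring
  rw [split]
  cases a
  · simp only [Bool.false_eq_true, if_false]
    rw [main]
    simp [D, ConN]
  · simp only [if_true]
    rw [Finset.sum_eq_sum_Ico_succ_bot n.2 H, add_left_comm, main]
    simp only [D, H, ConN, valR, if_true]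
    rw [add_comm]
    split_ifs
    · exact last_right_f N n m hz
    · exact last_right_n N n m hz

theorem relI (N r s : ℕ) (f f' : Fin (r + 1) → ℕ) (g : Fin (s + 1) → ℕ) (g' : Fin (s + 2) → ℕ)
    (hf : ∀ i : Fin r, f' i.castSucc = f i.castSucc) (hl : f' (Fin.last r) = f (Fin.last r) + 1)
    (hpos : 0 < f (Fin.last r)) (hg : ∀ i : Fin (s + 1), g' i.succ = g i) (hg0 : g' 0 = 1) :
    TL N r f' (fun x => TR N s g (ConN N x)) = TL N r f (fun x => TR N (s + 1) g' (ConN N x)) := by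
  refine TL_congr _ _ _ _ _ _ hf fun x => ?_
  rw [hl, TR_cons N s g 1 g' hg hg0, TR_smul, TR_smul]
  refine TR_congr _ _ _ _ _ _ (fun _ => rfl) fun z => ?_
  by_cases hx : 0 < (x.2 : ℕ)
  swap
  · simp [wL, hx]
  by_cases hz : 0 < (z.2 : ℕ)
  swap
  · simp [wR, hz]
  congr 1
  cases h : x.1
  · rw [sum_up_false N x z hx hz h]
    simp only [wL, hx, h]
    simp [pow_succ]
    ring
  · rw [sum_up_true N x z h]
    simp [wL, h, hpos.ne']

theorem relII (N r s : ℕ) (f : Fin (r + 1) → ℕ) (f' : Fin (r + 2) → ℕ) (g g' : Fin (s + 1) → ℕ)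
    (hf : ∀ i : Fin (r + 1), f' i.castSucc = f i) (hl : f' (Fin.last (r + 1)) = 1)
    (hg : ∀ i : Fin s, g i.succ = g' i.succ) (hg0 : g' 0 = g 0 + 1) :
    TL N (r + 1) f' (fun x => TR N s g (ConN N x)) = TL N r f (fun x => TR N s g' (ConN N x)) := by
  rw [TL_snoc N r f 1 f' hf hl]
  refine TL_congr _ _ _ _ _ _ (fun _ => rfl) fun x => ?_
  by_cases hx : 0 < (x.2 : ℕ)
  swap
  · simp [wL, hx]
  congr 1
  simp only [TR_smul]
  rw [TR_sum]
  refine TR_congr _ _ _ _ _ _ hg fun z => ?_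
  by_cases hz : 0 < (z.2 : ℕ)
  swap
  · simp [wR, hz]
  rw [sum_right N x z hx hz, hg0, wR_succ]
  ring

theorem relIII (N r : ℕ) (f : Fin (r + 1) → ℕ) (g : Fin 1 → ℕ) (hg : g 0 = 1) :
    TL N r f (fun x => if x.1 = true then 0 else Cnn N x.2 (N - 1) *
      (1 / ((x.2 : ℕ) : RatFunc ℚ))) = TL N r f (fun x => TR N 0 g (ConN N x)) := by
  refine TL_congr _ _ _ _ _ _ (fun _ => rfl) fun x => ?_
  by_cases hx : 0 < (x.2 : ℕ)
  swap
  · simp [wL, hx]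
  congr 1
  rw [TR_one, hg]
  cases h : x.1
  · rw [sum_top_false N x hx h]
    simp [div_eq_mul_inv]
  · rw [sum_top_true N x h]
    simp

/-- `Zcon` with the indices as tuples -/
noncomputable def ZF (N r s : ℕ) (f : Fin r → ℕ) (g : Fin s → ℕ) : RatFunc ℚ :=
  ∑ A : Finset (Fin r), ∑ B : Finset (Fin s),
    if ∀ i ∈ A, f i = 1 then
      ∑ n ∈ Finset.univ.filter (fun n : Fin r → Fin N =>
          (∀ i, 0 < (n i : ℕ)) ∧
          ∀ (i : Fin r) (h : (i : ℕ) + 1 < r),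
            if i ∉ A ∧ (⟨(i : ℕ) + 1, h⟩ : Fin r) ∈ A then
              n i < n ⟨(i : ℕ) + 1, h⟩
            else n i ≤ n ⟨(i : ℕ) + 1, h⟩),
        ∑ m ∈ Finset.univ.filter (fun m : Fin s → Fin N =>
            (∀ j, 0 < (m j : ℕ)) ∧
            ∀ (j : Fin s) (h : (j : ℕ) + 1 < s),
              if (⟨(j : ℕ) + 1, h⟩ : Fin s) ∈ B then m j < m ⟨(j : ℕ) + 1, h⟩
              else m j ≤ m ⟨(j : ℕ) + 1, h⟩),
          (-1 : RatFunc ℚ) ^ B.card *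
          (if hk : 0 < r then
            if hl : 0 < s then
              (if (⟨r - 1, Nat.sub_lt hk Nat.one_pos⟩ : Fin r) ∈ A then
                (if (⟨0, hl⟩ : Fin s) ∈ B then
                  Cff N (n ⟨r - 1, Nat.sub_lt hk Nat.one_pos⟩ : ℕ) (m ⟨0, hl⟩ : ℕ)
                else
                  Cfn N (n ⟨r - 1, Nat.sub_lt hk Nat.one_pos⟩ : ℕ) (m ⟨0, hl⟩ : ℕ))
              else
                (if (⟨0, hl⟩ : Fin s) ∈ B then
                  Cnf N (n ⟨r - 1, Nat.sub_lt hk Nat.one_pos⟩ : ℕ) (m ⟨0, hl⟩ : ℕ)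
                else
                  Cnn N (n ⟨r - 1, Nat.sub_lt hk Nat.one_pos⟩ : ℕ) (m ⟨0, hl⟩ : ℕ)))
            else 0
          else 0) *
          (∏ i : Fin r,
            if i ∈ A then 1 / ((N : RatFunc ℚ) - ((n i : ℕ) : RatFunc ℚ) + RatFunc.X)
            else 1 / (((n i : ℕ) : RatFunc ℚ)) ^ f i) *
          (∏ j : Fin s,
            if j ∈ B then
              1 / ((N : RatFunc ℚ) - ((m j : ℕ) : RatFunc ℚ) + RatFunc.X) ^ g j
            else 1 / (((m j : ℕ) : RatFunc ℚ)) ^ g j)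
    else 0

/-- `ZconUp` with the index as a tuple -/
noncomputable def ZFU (N r : ℕ) (f : Fin r → ℕ) : RatFunc ℚ :=
  ∑ A : Finset (Fin r),
    if ∀ i ∈ A, f i = 1 ∧ (i : ℕ) + 1 ≠ r then
      ∑ n ∈ Finset.univ.filter (fun n : Fin r → Fin N =>
          (∀ i, 0 < (n i : ℕ)) ∧
          ∀ (i : Fin r) (h : (i : ℕ) + 1 < r),
            if i ∉ A ∧ (⟨(i : ℕ) + 1, h⟩ : Fin r) ∈ A then
              n i < n ⟨(i : ℕ) + 1, h⟩
            else n i ≤ n ⟨(i : ℕ) + 1, h⟩),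
        (if hk : 0 < r then
          Cnn N (n ⟨r - 1, Nat.sub_lt hk Nat.one_pos⟩ : ℕ) (N - 1) *
            (1 / (((n ⟨r - 1, Nat.sub_lt hk Nat.one_pos⟩ : ℕ) : ℕ) : RatFunc ℚ))
        else 0) *
        ∏ i : Fin r,
          if i ∈ A then 1 / ((N : RatFunc ℚ) - ((n i : ℕ) : RatFunc ℚ) + RatFunc.X)
          else 1 / (((n i : ℕ) : RatFunc ℚ)) ^ f i
    else 0

theorem Zcon_eq_ZF (N : ℕ) (k l : List ℕ) :
    Zcon N k l = ZF N k.length l.length k.get l.get := rfl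

theorem ZconUp_eq_ZFU (N : ℕ) (k : List ℕ) : ZconUp N k = ZFU N k.length k.get := rfl

/-- subsets and indicator functions -/
noncomputable def boolEquiv (r : ℕ) : Finset (Fin r) ≃ (Fin r → Bool) where
  toFun A := fun i => decide (i ∈ A)
  invFun a := Finset.univ.filter (fun i => a i = true)
  left_inv A := by ext i; simp
  right_inv a := by ext i; simp

theorem sum_pairs (N r : ℕ) (Φ : (Fin r → Bool × Fin N) → RatFunc ℚ) :
    ∑ p, Φ p = ∑ A : Finset (Fin r), ∑ n : Fin r → Fin N, Φ (fun i => (decide (i ∈ A), n i)) := by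
  rw [← (Equiv.arrowProdEquivProdArrow (Fin r) (fun _ => Bool) (fun _ => Fin N)).symm.sum_comp,
    Fintype.sum_prod_type, ← (boolEquiv r).sum_comp]
  rfl

theorem prod_ite_all {ι : Type} [Fintype ι] (P : ι → Prop) [DecidablePred P]
    (F : ι → RatFunc ℚ) :
    ∏ i, (if P i then F i else 0) = if ∀ i, P i then ∏ i, F i else 0 := by
  split_ifs with h
  · exact Finset.prod_congr rfl fun i _ => if_pos (h i)
  · push Not at h
    obtain ⟨i, hi⟩ := h
    exact Finset.prod_eq_zero (Finset.mem_univ i) (if_neg hi)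

theorem adj_iff (r : ℕ) (P : Fin (r + 1) → Fin (r + 1) → Prop) :
    (∀ (i : Fin (r + 1)) (h : (i : ℕ) + 1 < r + 1), P i ⟨(i : ℕ) + 1, h⟩) ↔
      ∀ i : Fin r, P i.castSucc i.succ := by
  constructor
  · intro h i
    exact h i.castSucc (by simp)
  · intro h i hi
    exact h ⟨i, by omega⟩

theorem left_weight (N r : ℕ) (f : Fin (r + 1) → ℕ) (A : Finset (Fin (r + 1)))
    (n : Fin (r + 1) → Fin N) :
    (∏ i, wL N (f i) (decide (i ∈ A), n i)) *
      (∏ i : Fin r, cL N (decide (i.castSucc ∈ A), n i.castSucc) (decide (i.succ ∈ A), n i.succ)) =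
    if ∀ i ∈ A, f i = 1 then
      if ((∀ i, 0 < (n i : ℕ)) ∧
          ∀ (i : Fin (r + 1)) (h : (i : ℕ) + 1 < r + 1),
            if i ∉ A ∧ (⟨(i : ℕ) + 1, h⟩ : Fin (r + 1)) ∈ A then
              n i < n ⟨(i : ℕ) + 1, h⟩
            else n i ≤ n ⟨(i : ℕ) + 1, h⟩) then
        (∏ i : Fin (r + 1),
          if i ∈ A then 1 / ((N : RatFunc ℚ) - ((n i : ℕ) : RatFunc ℚ) + (RatFunc.X : RatFunc ℚ))
          else 1 / (((n i : ℕ) : RatFunc ℚ)) ^ f i)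
      else 0
    else 0 := by
  have hadj := adj_iff r (fun i j => if i ∉ A ∧ j ∈ A then n i < n j else n i ≤ n j)
  unfold wL cL
  rw [prod_ite_all, prod_ite_all, prod_ite_all]
  simp only [decide_eq_true_eq, Finset.prod_const_one]
  by_cases h1 : ∀ i ∈ A, f i = 1
  · by_cases h2 : ∀ i, 0 < (n i : ℕ)
    · rw [if_pos h1, if_pos h2, if_pos h1, mul_ite, mul_one, mul_zero]
      exact if_congr ⟨fun h => ⟨h2, hadj.2 h⟩, fun h => hadj.1 h.2⟩ rfl rfl
    · rw [if_neg h2, zero_mul, if_pos h1, if_neg (fun h => h2 h.1)]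
  · rw [if_neg h1, if_neg h1, ite_self, zero_mul]

theorem right_weight (N s : ℕ) (g : Fin (s + 1) → ℕ) (B : Finset (Fin (s + 1)))
    (m : Fin (s + 1) → Fin N) :
    (∏ j, wR N (g j) (decide (j ∈ B), m j)) *
      (∏ j : Fin s, cR N (decide (j.castSucc ∈ B), m j.castSucc) (decide (j.succ ∈ B), m j.succ)) =
    if ((∀ j, 0 < (m j : ℕ)) ∧
          ∀ (j : Fin (s + 1)) (h : (j : ℕ) + 1 < s + 1),
            if (⟨(j : ℕ) + 1, h⟩ : Fin (s + 1)) ∈ B then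
              m j < m ⟨(j : ℕ) + 1, h⟩
            else m j ≤ m ⟨(j : ℕ) + 1, h⟩) then
        (-1 : RatFunc ℚ) ^ B.card * (∏ j : Fin (s + 1),
          if j ∈ B then
            1 / ((N : RatFunc ℚ) - ((m j : ℕ) : RatFunc ℚ) + (RatFunc.X : RatFunc ℚ)) ^ g j
          else 1 / (((m j : ℕ) : RatFunc ℚ)) ^ g j)
      else 0 := by
  have hadj := adj_iff s (fun i j => if j ∈ B then m i < m j else m i ≤ m j)
  have hs : (-1 : RatFunc ℚ) ^ B.card = ∏ j : Fin (s + 1), (if j ∈ B then -1 else 1) := by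
    rw [Finset.prod_ite_mem, Finset.univ_inter, Finset.prod_const]
  unfold wR cR
  rw [prod_ite_all, prod_ite_all, hs, ← Finset.prod_mul_distrib]
  simp only [decide_eq_true_eq, Finset.prod_const_one]
  by_cases h2 : ∀ i, 0 < (m i : ℕ)
  · rw [if_pos h2, mul_ite, mul_one, mul_zero]
    exact if_congr ⟨fun h => ⟨h2, hadj.2 h⟩, fun h => hadj.1 h.2⟩ rfl rfl
  · rw [if_neg h2, zero_mul, if_neg (fun h => h2 h.1)]

theorem ZF_eq (N r s : ℕ) (f : Fin (r + 1) → ℕ) (g : Fin (s + 1) → ℕ) :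
    ZF N (r + 1) (s + 1) f g = TL N r f (fun x => TR N s g (ConN N x)) := by
  unfold TL TR ZF
  rw [sum_pairs]
  refine Finset.sum_congr rfl fun A _ => ?_
  simp only [sum_pairs, left_weight, right_weight]
  have hlast : ∀ h, (⟨r + 1 - 1, h⟩ : Fin (r + 1)) = Fin.last r := fun h => rfl
  have hzero : ∀ h, (⟨0, h⟩ : Fin (s + 1)) = 0 := fun h => rfl
  simp only [hlast, hzero, Nat.succ_pos, dite_true]
  by_cases h1 : ∀ i ∈ A, f i = 1
  · simp only [if_pos h1]
    rw [Finset.sum_comm, Finset.sum_filter]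
    refine Finset.sum_congr rfl fun n _ => ?_
    rw [ite_mul, zero_mul]
    refine if_congr Iff.rfl ?_ rfl
    rw [Finset.mul_sum]
    refine Finset.sum_congr rfl fun B _ => ?_
    rw [Finset.mul_sum, Finset.sum_filter]
    refine Finset.sum_congr rfl fun m _ => ?_
    split_ifs with hQ <;> simp [ConN, *] <;> ring
  · simp only [if_neg h1, zero_mul, Finset.sum_const_zero]

theorem ZFU_eq (N r : ℕ) (f : Fin (r + 1) → ℕ) :
    ZFU N (r + 1) f = TL N r f (fun x => if x.1 = true then 0 else Cnn N x.2 (N - 1) *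
      (1 / ((x.2 : ℕ) : RatFunc ℚ))) := by
  unfold TL ZFU
  rw [sum_pairs]
  refine Finset.sum_congr rfl fun A _ => ?_
  simp only [left_weight]
  have hlast : ∀ h, (⟨r + 1 - 1, h⟩ : Fin (r + 1)) = Fin.last r := fun h => rfl
  simp only [hlast, Nat.succ_pos, dite_true]
  by_cases hA : Fin.last r ∈ A
  · rw [if_neg (fun h => (h _ hA).2 (by simp))]
    simp [hA]
  · have hiff : (∀ i ∈ A, f i = 1 ∧ (i : ℕ) + 1 ≠ r + 1) ↔ ∀ i ∈ A, f i = 1 := by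
      refine ⟨fun h i hi => (h i hi).1, fun h i hi => ⟨h i hi, fun he => hA ?_⟩⟩
      have : i = Fin.last r := Fin.ext (by simp; omega)
      rwa [← this]
    rw [if_congr hiff rfl rfl]
    by_cases h1 : ∀ i ∈ A, f i = 1
    · rw [if_pos h1, Finset.sum_filter]
      refine Finset.sum_congr rfl fun n _ => ?_
      rw [if_pos h1]
      simp only [hA, decide_false, Bool.false_eq_true, if_false]
      rw [ite_mul, zero_mul, mul_comm]
    · simp [h1]

theorem ZF_cast (N r s r' s' : ℕ) (hr : r = r') (hs : s = s') (f : Fin r → ℕ) (g : Fin s → ℕ) :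
    ZF N r s f g = ZF N r' s' (fun i => f (i.cast hr.symm)) (fun i => g (i.cast hs.symm)) := by
  subst hr; subst hs; rfl

theorem ZFU_cast (N r r' : ℕ) (hr : r = r') (f : Fin r → ℕ) :
    ZFU N r f = ZFU N r' (fun i => f (i.cast hr.symm)) := by
  subst hr; rfl

theorem Zcon_eq_T (N r s : ℕ) (k l : List ℕ) (hk : k.length = r + 1) (hl : l.length = s + 1) :
    Zcon N k l = TL N r (fun i => k.get (i.cast hk.symm))
      (fun x => TR N s (fun i => l.get (i.cast hl.symm)) (ConN N x)) := by
  rw [Zcon_eq_ZF, ZF_cast N _ _ _ _ hk hl, ZF_eq]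

theorem ZconUp_eq_T (N r : ℕ) (k : List ℕ) (hk : k.length = r + 1) :
    ZconUp N k = TL N r (fun i => k.get (i.cast hk.symm))
      (fun x => if x.1 = true then 0 else Cnn N x.2 (N - 1) *
      (1 / ((x.2 : ℕ) : RatFunc ℚ))) := by
  rw [ZconUp_eq_ZFU, ZFU_cast N _ _ hk, ZFU_eq]

/-- **Transport relations** for the connected sum:
(i) `Z_{N,t}(k_↑;l) = Z_{N,t}(k;←l)`, (ii) `Z_{N,t}(k_→;l) = Z_{N,t}(k;↑l)`, and
(iii) `Z_{N,t}(k_↑;∅) = Z_{N,t}(k;(1))`. -/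
theorem transport_relations (N : ℕ) (hNpos : 0 < N) (k l : List ℕ)
    (hk : k ≠ []) (hl : l ≠ []) (hkpos : ∀ x ∈ k, 0 < x) (hlpos : ∀ x ∈ l, 0 < x) :
    Zcon N (upArrow k) l = Zcon N k (1 :: l) ∧
    Zcon N (k ++ [1]) l = Zcon N k (headUp l) ∧
    ZconUp N k = Zcon N k [1] := by
  obtain ⟨k', a, rfl⟩ : ∃ k' a, k = k' ++ [a] :=
    ⟨k.dropLast, k.getLast hk, (List.dropLast_append_getLast hk).symm⟩
  obtain ⟨b, l', rfl⟩ := List.exists_cons_of_ne_nil hl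
  have ha : 0 < a := hkpos a (by simp)
  have hup : upArrow (k' ++ [a]) = k' ++ [a + 1] := by simp [upArrow]
  have hlen : ∀ c, (k' ++ [c]).length = k'.length + 1 := fun c => by simp
  have hlen2 : (k' ++ [a] ++ [1]).length = k'.length + 1 + 1 := by simp
  have hc : ∀ c, (c :: l').length = l'.length + 1 := fun c => by simp
  have hc2 : (1 :: b :: l').length = l'.length + 1 + 1 := by simp
  refine ⟨?_, ?_, ?_⟩
  · rw [hup, Zcon_eq_T N _ _ _ _ (hlen (a + 1)) (hc b), Zcon_eq_T N _ _ _ _ (hlen a) hc2]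
    apply relI
    · intro i
      simp [List.getElem_append]
    · simp
    · simpa using ha
    · intro i
      simp
    · simp
  · rw [headUp, Zcon_eq_T N _ _ _ _ hlen2 (hc b), Zcon_eq_T N _ _ _ _ (hlen a) (hc (b + 1))]
    apply relII
    · intro i
      simp only [List.get_eq_getElem, Fin.val_cast, Fin.val_castSucc]
      rw [List.getElem_append_left]
    · simp
    · intro i
      simp
    · simp
  · rw [ZconUp_eq_T N _ _ (hlen a), Zcon_eq_T N _ 0 _ [1] (hlen a) rfl]
    apply relIII
    simp
end
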